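/- Let A be a finite-dimensional Z-graded K-algebra with triangular decomposition (A⁻,T,A⁺) such that T is split semisimple. If the negative Borel B⁻ is isomorphic to the (right-module-twisted) K-linear dual of the positive Borel B⁺ as graded (T,T)-bimodules (i.e., Bᵢ⁻ ≅ (B₋ᵢ⁺)^⊛ as T-bimodules for all i ∈ Z), then [Δ̄(λ)] = [∇̄(λ)] in K₀(G(A)) for all simple graded T-modules λ (A is BGG). -/

import Mathlib

open scoped TensorProduct

universe u

namespace TriangularPaper

variable (K A : Type u) [Field K] [Ring A] [Algebra K A]

/-- The multiplication map `M ⊗ N → A` for two `K`-subspaces of `A`. -/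
noncomputable def mulMap (M N : Submodule K A) : (↥M ⊗[K] ↥N) →ₗ[K] A :=
  (LinearMap.mul' K A).comp (TensorProduct.map M.subtype N.subtype)

/-- The triple multiplication map `(P ⊗ Q) ⊗ R → A`. -/
noncomputable def triMulMap (P Q R : Submodule K A) :
    ((↥P ⊗[K] ↥Q) ⊗[K] ↥R) →ₗ[K] A :=
  (LinearMap.mul' K A).comp (TensorProduct.map (mulMap K A P Q) R.subtype)

/-- A triangular decomposition `(A⁻, T, A⁺)` of the finite-dimensional graded algebra `A`
with internal grading `𝒜`, in the sense of Holmes–Nakano. -/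
structure TriangularDecomposition (𝒜 : ℤ → Submodule K A)
    (Am T Ap : Subalgebra K A) : Prop where
  /-- `𝒜` is a grading of `A` -/
  internal : DirectSum.IsInternal 𝒜
  one_mem : (1 : A) ∈ 𝒜 0
  mul_mem : ∀ i j : ℤ, ∀ a b : A, a ∈ 𝒜 i → b ∈ 𝒜 j → a * b ∈ 𝒜 (i + j)
  /-- multiplication `A⁻ ⊗ T ⊗ A⁺ → A` is a linear isomorphism -/
  mul_bij : Function.Bijective (triMulMap K A Am.toSubmodule T.toSubmodule Ap.toSubmodule)
  /-- `T` is concentrated in degree `0` -/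
  T_deg0 : T.toSubmodule ≤ 𝒜 0
  /-- `A⁻` is supported in nonpositive degrees -/
  neg_supp : Am.toSubmodule ≤ ⨆ n : ℕ, 𝒜 (-(n : ℤ))
  /-- `A⁺` is supported in nonnegative degrees -/
  pos_supp : Ap.toSubmodule ≤ ⨆ n : ℕ, 𝒜 (n : ℤ)
  /-- `A⁻` is a graded subalgebra -/
  neg_graded : Am.toSubmodule = ⨆ i : ℤ, Am.toSubmodule ⊓ 𝒜 i
  /-- `A⁺` is a graded subalgebra -/
  pos_graded : Ap.toSubmodule = ⨆ i : ℤ, Ap.toSubmodule ⊓ 𝒜 i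
  /-- `A⁻₀ = K` -/
  neg_deg0 : Am.toSubmodule ⊓ 𝒜 0 = Submodule.span K {(1 : A)}
  /-- `A⁺₀ = K` -/
  pos_deg0 : Ap.toSubmodule ⊓ 𝒜 0 = Submodule.span K {(1 : A)}
  /-- `A⁺T = TA⁺` as subspaces of `A` -/
  comm_pos : Ap.toSubmodule * T.toSubmodule = T.toSubmodule * Ap.toSubmodule
  /-- `A⁻T = TA⁻` as subspaces of `A` -/
  comm_neg : Am.toSubmodule * T.toSubmodule = T.toSubmodule * Am.toSubmodule
  /-- `T` is a split `K`-algebra -/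
  T_split : ∀ (V : Type u) [AddCommGroup V] [Module ↥T V], IsSimpleModule ↥T V →
    ∀ f : V →ₗ[↥T] V, ∃ c : K, ∀ v, f v = algebraMap K ↥T c • v

/-- The negative Borel subalgebra `B⁻ = A⁻T` (as a subspace). -/
noncomputable def Bneg (Am T : Subalgebra K A) : Submodule K A :=
  Am.toSubmodule * T.toSubmodule

/-- The positive Borel subalgebra `B⁺ = A⁺T` (as a subspace). -/
noncomputable def Bpos (T Ap : Subalgebra K A) : Submodule K A :=
  Ap.toSubmodule * T.toSubmodule

/-- The augmentation ideal `J⁺` of the positive Borel subalgebra. -/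
noncomputable def Jpos (𝒜 : ℤ → Submodule K A) (T Ap : Subalgebra K A) : Submodule K A :=
  ⨆ (i : ℤ) (_ : 0 < i), Bpos K A T Ap ⊓ 𝒜 i

/-- The augmentation ideal `J⁻` of the negative Borel subalgebra. -/
noncomputable def Jneg (𝒜 : ℤ → Submodule K A) (Am T : Subalgebra K A) : Submodule K A :=
  ⨆ (i : ℤ) (_ : i < 0), Bneg K A Am T ⊓ 𝒜 i

/-- `(D, ι)` realizes the proper standard module `Δ̄(M) = A ⊗_{B⁺} Inf_T^{B⁺} M`,
expressed through its universal property `Hom_A(Δ̄(M), N) ≅ Hom_{B⁺}(Inf M, Res N)`. -/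
def IsProperStandardFor (𝒜 : ℤ → Submodule K A) (T Ap : Subalgebra K A)
    (M : Type u) [AddCommGroup M] [Module ↥T M]
    (D : Type u) [AddCommGroup D] [Module A D] (ι : M →+ D) : Prop :=
  (∀ (t : ↥T) (m : M), ι (t • m) = (t : A) • ι m) ∧
  (∀ a ∈ Jpos K A 𝒜 T Ap, ∀ m : M, a • ι m = 0) ∧
  ∀ (N : Type u) [AddCommGroup N] [Module A N] (f : M →+ N),
    (∀ (t : ↥T) (m : M), f (t • m) = (t : A) • f m) →
    (∀ a ∈ Jpos K A 𝒜 T Ap, ∀ m : M, a • f m = 0) →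
    ∃! F : D →ₗ[A] N, ∀ m, F (ι m) = f m

/-- `(D, p)` realizes the proper costandard module `∇̄(M)`, expressed through its
couniversal property `Hom_A(N, ∇̄(M)) ≅ Hom_{B⁻}(Res N, Inf M)`. -/
def IsProperCostandardFor (𝒜 : ℤ → Submodule K A) (Am T : Subalgebra K A)
    (M : Type u) [AddCommGroup M] [Module ↥T M]
    (D : Type u) [AddCommGroup D] [Module A D] (p : D →+ M) : Prop :=
  (∀ (t : ↥T) (x : D), p ((t : A) • x) = t • p x) ∧
  (∀ a ∈ Jneg K A 𝒜 Am T, ∀ x : D, p (a • x) = 0) ∧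
  ∀ (N : Type u) [AddCommGroup N] [Module A N] (f : N →+ M),
    (∀ (t : ↥T) (x : N), f ((t : A) • x) = t • f x) →
    (∀ a ∈ Jneg K A 𝒜 Am T, ∀ x : N, f (a • x) = 0) →
    ∃! F : N →ₗ[A] D, ∀ x, p (F x) = f x

/-- A compatible grading on an `A`-module `D`, making it an object of `𝒢(A)`. -/
def IsModuleGrading (𝒜 : ℤ → Submodule K A) {D : Type u} [AddCommGroup D] [Module A D]
    [Module K D] [IsScalarTower K A D] (ℳ : ℤ → Submodule K D) : Prop :=
  DirectSum.IsInternal ℳ ∧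
    ∀ (i j : ℤ) (a : A) (x : D), a ∈ 𝒜 i → x ∈ ℳ j → a • x ∈ ℳ (i + j)

end TriangularPaper

namespace TriangularPaper

variable (K A : Type u) [Field K] [Ring A] [Algebra K A]

/-- Two `R`-modules have the same class in the Grothendieck group `K₀`:
they admit finite filtrations with isomorphic factors up to permutation. -/
def MatchingFactors (R : Type u) [Ring R] (X Y : Type u) [AddCommGroup X] [Module R X]
    [AddCommGroup Y] [Module R Y] : Prop :=
  ∃ (n : ℕ) (F : Fin (n + 1) → Submodule R X) (G : Fin (n + 1) → Submodule R Y)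
    (σ : Equiv.Perm (Fin n)),
    Monotone F ∧ Monotone G ∧ F 0 = ⊥ ∧ F (Fin.last n) = ⊤ ∧ G 0 = ⊥ ∧ G (Fin.last n) = ⊤ ∧
    ∀ k : Fin n, Nonempty
      ((↥(F k.succ) ⧸ Submodule.comap (F k.succ).subtype (F k.castSucc)) ≃ₗ[R]
       (↥(G (σ k).succ) ⧸ Submodule.comap (G (σ k).succ).subtype (G (σ k).castSucc)))

/-- The induced degree-`i` piece on the subquotient `Q/P` of a graded module. -/
noncomputable def factorPiece {M : Type u} [AddCommGroup M] [Module A M] [Module K M]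
    [IsScalarTower K A M] (ℳ : ℤ → Submodule K M) (P Q : Submodule A M) (i : ℤ) :
    Set (↥Q ⧸ Submodule.comap Q.subtype P) :=
  (Submodule.comap Q.subtype P).mkQ '' {x : ↥Q | (x : M) ∈ ℳ i}

/-- Two graded `A`-modules have the same class in the Grothendieck group `K₀(𝒢(A))`:
they admit finite filtrations by graded submodules whose factors are isomorphic as
graded `A`-modules, up to permutation. -/
def GradedMatchingFactors {M N : Type u} [AddCommGroup M] [Module A M] [Module K M]
    [IsScalarTower K A M] [AddCommGroup N] [Module A N] [Module K N] [IsScalarTower K A N]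
    (ℳ : ℤ → Submodule K M) (𝒩 : ℤ → Submodule K N) : Prop :=
  ∃ (n : ℕ) (F : Fin (n + 1) → Submodule A M) (G : Fin (n + 1) → Submodule A N)
    (σ : Equiv.Perm (Fin n)),
    Monotone F ∧ Monotone G ∧ F 0 = ⊥ ∧ F (Fin.last n) = ⊤ ∧ G 0 = ⊥ ∧ G (Fin.last n) = ⊤ ∧
    ∀ k : Fin n, ∃ e :
        (↥(F k.succ) ⧸ Submodule.comap (F k.succ).subtype (F k.castSucc)) ≃ₗ[A]
        (↥(G (σ k).succ) ⧸ Submodule.comap (G (σ k).succ).subtype (G (σ k).castSucc)),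
      ∀ i : ℤ, e '' factorPiece K A ℳ (F k.castSucc) (F k.succ) i =
        factorPiece K A 𝒩 (G (σ k).castSucc) (G (σ k).succ) i

end TriangularPaper

namespace TriangularPaper

section Components

variable {K X : Type u} [Field K] [AddCommGroup X] [Module K X]

/-- The projection onto the degree-`i` piece of a graded vector space. -/
noncomputable def degreeProj {ℳ : ℤ → Submodule K X} (h : DirectSum.IsInternal ℳ) (i : ℤ) :
    X →ₗ[K] X :=
  letI := h.chooseDecomposition
  (ℳ i).subtype ∘ₗ DirectSum.component K ℤ (fun i => ↥(ℳ i)) i ∘ₗ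
    (DirectSum.decomposeLinearEquiv ℳ).toLinearMap

variable {ℳ : ℤ → Submodule K X} (h : DirectSum.IsInternal ℳ)

lemma degreeProj_mem (i : ℤ) (x : X) : degreeProj h i x ∈ ℳ i := by
  simp only [degreeProj, LinearMap.comp_apply, Submodule.subtype_apply, SetLike.coe_mem]

lemma degreeProj_of_mem {i : ℤ} {x : X} (hx : x ∈ ℳ i) : degreeProj h i x = x :=
  let _ := h.chooseDecomposition
  DirectSum.decompose_of_mem_same ℳ hx

lemma degreeProj_of_mem_ne {i j : ℤ} {x : X} (hx : x ∈ ℳ i) (hij : i ≠ j) :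
    degreeProj h j x = 0 :=
  let _ := h.chooseDecomposition
  DirectSum.decompose_of_mem_ne ℳ hx hij

lemma exists_sum_degreeProj (x : X) : ∃ s : Finset ℤ, x = ∑ i ∈ s, degreeProj h i x := by
  classical
  let _ := h.chooseDecomposition
  exact ⟨_, (DirectSum.sum_support_decompose ℳ x).symm⟩

lemma mem_of_degreeProj_mem {S : Type*} [SetLike S X] [AddSubmonoidClass S X] {P : S} {x : X}
    (hx : ∀ i, degreeProj h i x ∈ P) : x ∈ P := by
  obtain ⟨s, hs⟩ := exists_sum_degreeProj h x
  rw [hs]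
  exact sum_mem fun i _ => hx i

end Components

lemma finite_degrees {K X : Type u} [Field K] [AddCommGroup X] [Module K X]
    [FiniteDimensional K X] {ℳ : ℤ → Submodule K X} (h : DirectSum.IsInternal ℳ) :
    {i | ℳ i ≠ ⊥}.Finite :=
  WellFoundedGT.finite_ne_bot_of_iSupIndep h.submodule_iSupIndep

section GradedModules

variable {K A X : Type u} [Field K] [Ring A] [Algebra K A] {𝒜 : ℤ → Submodule K A}
  [AddCommGroup X] [Module A X] [Module K X] [IsScalarTower K A X] {ℳ : ℤ → Submodule K X}

lemma degreeProj_smul (h : IsModuleGrading K A 𝒜 ℳ) {j : ℤ} {a : A} (ha : a ∈ 𝒜 j) (k : ℤ)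
    (x : X) : degreeProj h.1 k (a • x) = a • degreeProj h.1 (k - j) x := by
  obtain ⟨s, hs⟩ := exists_sum_degreeProj h.1 x
  have key : ∀ i, degreeProj h.1 k (a • degreeProj h.1 i x) =
      a • degreeProj h.1 (k - j) (degreeProj h.1 i x) := by
    intro i
    have hx := degreeProj_mem h.1 i x
    by_cases hi : i = k - j
    · subst hi
      rw [degreeProj_of_mem h.1 hx, degreeProj_of_mem h.1]
      simpa using h.2 _ _ _ _ ha hx
    · rw [degreeProj_of_mem_ne h.1 hx hi, smul_zero,
        degreeProj_of_mem_ne h.1 (h.2 _ _ _ _ ha hx) (by omega)]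
  rw [hs, Finset.smul_sum, map_sum, map_sum, Finset.smul_sum]
  exact Finset.sum_congr rfl fun i _ => key i

lemma degreeProj_smul_of_mem (h𝒜 : DirectSum.IsInternal 𝒜) (h : IsModuleGrading K A 𝒜 ℳ)
    {i : ℤ} {x : X} (hx : x ∈ ℳ i) (k : ℤ) (a : A) :
    degreeProj h.1 k (a • x) = degreeProj h𝒜 (k - i) a • x := by
  obtain ⟨s, hs⟩ := exists_sum_degreeProj h𝒜 a
  have key : ∀ j, degreeProj h.1 k (degreeProj h𝒜 j a • x) =
      degreeProj h𝒜 (k - i) (degreeProj h𝒜 j a) • x := by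
    intro j
    have ha := degreeProj_mem h𝒜 j a
    by_cases hj : j = k - i
    · subst hj
      rw [degreeProj_of_mem h𝒜 ha, degreeProj_of_mem h.1]
      simpa using h.2 _ _ _ _ ha hx
    · rw [degreeProj_of_mem_ne h𝒜 ha hj, zero_smul,
        degreeProj_of_mem_ne h.1 (h.2 _ _ _ _ ha hx) (by omega)]
  rw [hs, Finset.sum_smul, map_sum, map_sum, Finset.sum_smul]
  exact Finset.sum_congr rfl fun i _ => key i

/-- The fixed space of the action of `a`; for an idempotent `a` this is `aX`. -/
noncomputable def fixedSpace (K X : Type u) [Field K] [AddCommGroup X] [Module A X] [Algebra K A]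
    [Module K X] [IsScalarTower K A X] (a : A) : Submodule K X :=
  LinearMap.eqLocus (Algebra.lsmul K K X a) LinearMap.id

/-- The degree-`i` part of `eP`, for a graded submodule `P` and an idempotent `e`. -/
noncomputable def weightSpace (ℳ : ℤ → Submodule K X) (e : A) (i : ℤ) (P : Submodule A X) :
    Submodule K X :=
  P.restrictScalars K ⊓ ℳ i ⊓ fixedSpace K X e

lemma mem_weightSpace {e : A} {i : ℤ} {P : Submodule A X} {x : X} :
    x ∈ weightSpace ℳ e i P ↔ (x ∈ P ∧ x ∈ ℳ i) ∧ e • x = x := Iff.rfl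

lemma finrank_map_add_finrank_inf_ker {Z : Type*} [AddCommGroup Z] [Module K Z]
    (V : Submodule K X) [FiniteDimensional K V] (g : X →ₗ[K] Z) :
    Module.finrank K (V.map g) + Module.finrank K ↥(V ⊓ LinearMap.ker g) =
      Module.finrank K V := by
  rw [← LinearMap.finrank_range_add_finrank_ker (g.domRestrict V), LinearMap.range_domRestrict,
    LinearMap.ker_domRestrict]
  congr 1
  rw [(Submodule.equivSubtypeMap V (Submodule.comap V.subtype (LinearMap.ker g))).finrank_eq,
    Submodule.map_comap_subtype]

/-- The multiplicity of the weight `(e, i)` in the graded section `Q / P`. -/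
noncomputable def sectionMult (ℳ : ℤ → Submodule K X) (P Q : Submodule A X) (e : A) (i : ℤ) : ℕ :=
  Module.finrank K ((weightSpace ℳ e i Q).map (P.mkQ.restrictScalars K))

lemma sectionMult_add [FiniteDimensional K X] {P Q : Submodule A X} (hPQ : P ≤ Q) (e : A)
    (i : ℤ) : sectionMult ℳ P Q e i + Module.finrank K (weightSpace ℳ e i P) =
      Module.finrank K (weightSpace ℳ e i Q) := by
  rw [sectionMult, ← finrank_map_add_finrank_inf_ker (weightSpace ℳ e i Q)
    (P.mkQ.restrictScalars K)]
  suffices weightSpace ℳ e i P = weightSpace ℳ e i Q ⊓ LinearMap.ker (P.mkQ.restrictScalars K) by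
    rw [this]
  ext x
  simp only [Submodule.mem_inf, mem_weightSpace, LinearMap.mem_ker,
    LinearMap.coe_restrictScalars, Submodule.mkQ_apply, Submodule.Quotient.mk_eq_zero]
  constructor
  · rintro ⟨⟨h1, h2⟩, h3⟩
    exact ⟨⟨⟨hPQ h1, h2⟩, h3⟩, h1⟩
  · rintro ⟨⟨⟨h1, h2⟩, h3⟩, h4⟩
    exact ⟨⟨h4, h2⟩, h3⟩

lemma sectionMult_ne_zero_iff [FiniteDimensional K X] {P Q : Submodule A X} {e : A} {i : ℤ} :
    sectionMult ℳ P Q e i ≠ 0 ↔ ∃ x ∈ Q, x ∈ ℳ i ∧ e • x = x ∧ x ∉ P := by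
  rw [sectionMult, Ne, Submodule.finrank_eq_zero, ← le_bot_iff, Submodule.map_le_iff_le_comap,
    ← LinearMap.ker, SetLike.not_le_iff_exists]
  simp only [mem_weightSpace, LinearMap.mem_ker,
    LinearMap.coe_restrictScalars, Submodule.mkQ_apply, Submodule.Quotient.mk_eq_zero, and_assoc]

/-- A submodule is graded if it contains the homogeneous components of its elements. -/
def IsGradedSub (h : DirectSum.IsInternal ℳ) (P : Submodule A X) : Prop :=
  ∀ x ∈ P, ∀ i, degreeProj h i x ∈ P

lemma isGradedSub_sup_span (h𝒜 : DirectSum.IsInternal 𝒜) (h : IsModuleGrading K A 𝒜 ℳ)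
    {P : Submodule A X} (hP : IsGradedSub h.1 P) {i : ℤ} {x : X} (hx : x ∈ ℳ i) :
    IsGradedSub h.1 (P ⊔ Submodule.span A {x}) := by
  intro z hz k
  obtain ⟨p, hp, y, hy, rfl⟩ := Submodule.mem_sup.1 hz
  obtain ⟨a, rfl⟩ := Submodule.mem_span_singleton.1 hy
  rw [map_add, degreeProj_smul_of_mem h𝒜 h hx]
  exact add_mem (Submodule.mem_sup_left (hP p hp k)) (Submodule.mem_sup_right
    (Submodule.smul_mem _ _ (Submodule.mem_span_singleton_self x)))

variable (A) in
/-- The poset of graded submodules. -/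
abbrev GradedSub (h : DirectSum.IsInternal ℳ) : Type u := {P : Submodule A X // IsGradedSub h P}

lemma exists_smul_of_covBy (h𝒜 : DirectSum.IsInternal 𝒜) (h : IsModuleGrading K A 𝒜 ℳ)
    {P Q : GradedSub A h.1} (hPQ : P ⋖ Q) {i : ℤ} {x : X} (hx : x ∈ ℳ i) (hxQ : x ∈ Q.1)
    (hxP : x ∉ P.1) {q : X} (hq : q ∈ Q.1) : ∃ a : A, q - a • x ∈ P.1 := by
  have hle : P ≤ ⟨_, isGradedSub_sup_span h𝒜 h P.2 hx⟩ := (le_sup_left : P.1 ≤ _)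
  have hle' : (⟨_, isGradedSub_sup_span h𝒜 h P.2 hx⟩ : GradedSub A h.1) ≤ Q :=
    (sup_le hPQ.le ((Submodule.span_singleton_le_iff_mem _ _).2 hxQ) : _ ≤ Q.1)
  have hmem : x ∈ P.1 ⊔ Submodule.span A {x} :=
    Submodule.mem_sup_right (Submodule.mem_span_singleton_self x)
  rcases hPQ.eq_or_eq hle hle' with heq | heq
  · exact absurd ((congrArg Subtype.val heq) ▸ hmem) hxP
  · rw [← heq] at hq
    obtain ⟨p, hp, y, hy, rfl⟩ := Submodule.mem_sup.1 hq
    obtain ⟨a, rfl⟩ := Submodule.mem_span_singleton.1 hy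
    exact ⟨a, by simpa using hp⟩

lemma exists_homogeneous_smul_of_covBy (h𝒜 : DirectSum.IsInternal 𝒜)
    (h : IsModuleGrading K A 𝒜 ℳ) {P Q : GradedSub A h.1} (hPQ : P ⋖ Q) {i : ℤ} {x : X}
    (hx : x ∈ ℳ i) (hxQ : x ∈ Q.1) (hxP : x ∉ P.1) {k : ℤ} {q : X} (hq : q ∈ Q.1)
    (hqk : q ∈ ℳ k) : ∃ a ∈ 𝒜 (k - i), q - a • x ∈ P.1 := by
  obtain ⟨a, ha⟩ := exists_smul_of_covBy h𝒜 h hPQ hx hxQ hxP hq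
  refine ⟨_, degreeProj_mem h𝒜 (k - i) a, ?_⟩
  have := P.2 _ ha k
  rwa [map_sub, degreeProj_of_mem h.1 hqk, degreeProj_smul_of_mem h𝒜 h hx] at this

lemma smul_mem_iff_forall_degreeProj (h𝒜 : DirectSum.IsInternal 𝒜) (h : IsModuleGrading K A 𝒜 ℳ)
    {P : Submodule A X} (hP : IsGradedSub h.1 P) {i : ℤ} {x : X} (hx : x ∈ ℳ i) (a : A) :
    a • x ∈ P ↔ ∀ j, degreeProj h𝒜 j a • x ∈ P := by
  constructor
  · intro ha j
    have := hP _ ha (j + i)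
    rwa [degreeProj_smul_of_mem h𝒜 h hx, add_sub_cancel_right] at this
  · intro ha
    refine mem_of_degreeProj_mem h.1 fun k => ?_
    rw [degreeProj_smul_of_mem h𝒜 h hx]
    exact ha _

/-- The submodule `Q` is contained in `P` in all degrees above `i`. -/
def IsTopDegree (ℳ : ℤ → Submodule K X) (P Q : Submodule A X) (i : ℤ) : Prop :=
  ∀ j, i < j → ∀ x ∈ Q, x ∈ ℳ j → x ∈ P

lemma exists_gradedSub_chain [FiniteDimensional K X] (h : DirectSum.IsInternal ℳ) :
    ∃ (n : ℕ) (F : ℕ → GradedSub A h), (F 0).1 = ⊥ ∧ (F n).1 = ⊤ ∧ ∀ i < n, F i ⋖ F (i + 1) := by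
  have : IsNoetherian A X := isNoetherian_of_tower K inferInstance
  have : IsArtinian A X := isArtinian_of_tower K inferInstance
  have : WellFoundedLT (GradedSub A h) :=
    StrictMono.wellFoundedLT (f := fun P : GradedSub A h => P.1) fun _ _ hlt => hlt
  have : WellFoundedGT (GradedSub A h) :=
    StrictMono.wellFoundedGT (f := fun P : GradedSub A h => P.1) fun _ _ hlt => hlt
  let bot : GradedSub A h := ⟨⊥, fun x hx i => by
    rw [Submodule.mem_bot] at hx ⊢; rw [hx, map_zero]⟩
  let top : GradedSub A h := ⟨⊤, fun x hx i => Submodule.mem_top⟩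
  obtain ⟨F, h0, n, hn, hF⟩ := exists_covBy_seq_of_wellFoundedLT_wellFoundedGT_of_le
    (show bot ≤ top from (bot_le : (⊥ : Submodule A X) ≤ ⊤))
  exact ⟨n, F, by rw [h0], by rw [hn], hF⟩

end GradedModules

lemma exists_isTopDegree {K A X : Type u} [Field K] [Ring A] [AddCommGroup X] [Module A X]
    [Module K X] [FiniteDimensional K X] {ℳ : ℤ → Submodule K X} (h : DirectSum.IsInternal ℳ)
    {P Q : GradedSub A h} (hPQ : P < Q) :
    ∃ i, (∃ x ∈ Q.1, x ∈ ℳ i ∧ x ∉ P.1) ∧ IsTopDegree ℳ P.1 Q.1 i := by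
  obtain ⟨q, hq, hqP⟩ := SetLike.exists_of_lt (show P.1 < Q.1 from hPQ)
  let S : Set ℤ := {i | ∃ x ∈ Q.1, x ∈ ℳ i ∧ x ∉ P.1}
  have hS : S.Finite := (finite_degrees h).subset fun i ⟨x, _, hx, hxP⟩ h0 => by
    rw [h0, Submodule.mem_bot] at hx
    exact hxP (hx ▸ zero_mem _)
  have hne : S.Nonempty := by
    by_contra hemp
    refine hqP (mem_of_degreeProj_mem h fun i => ?_)
    by_contra hi
    exact hemp ⟨i, _, Q.2 q hq i, degreeProj_mem h i q, hi⟩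
  obtain ⟨i, hi, hmax⟩ := hS.exists_maximalFor id _ hne
  refine ⟨i, hi, fun j hj x hx hxj => ?_⟩
  by_contra hxP
  exact absurd (hmax (show j ∈ S from ⟨x, hx, hxj, hxP⟩) hj.le) (by simpa using hj)

end TriangularPaper

namespace TriangularPaper

section HomogeneousSubspaces

variable {K A : Type u} [Field K] [Ring A] [Algebra K A] {𝒜 : ℤ → Submodule K A}
  {Am T Ap : Subalgebra K A}

lemma TriangularDecomposition.isModuleGrading (h : TriangularDecomposition K A 𝒜 Am T Ap) :
    IsModuleGrading K A 𝒜 𝒜 :=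
  ⟨h.internal, fun i j a x ha hx => h.mul_mem i j a x ha hx⟩

lemma degreeProj_mul (h : IsModuleGrading K A 𝒜 𝒜) {j : ℤ} {a : A} (ha : a ∈ 𝒜 j) (k : ℤ)
    (b : A) : degreeProj h.1 k (a * b) = a * degreeProj h.1 (k - j) b :=
  degreeProj_smul h ha k b

lemma degreeProj_mul_of_mem (h : IsModuleGrading K A 𝒜 𝒜) {i : ℤ} {b : A} (hb : b ∈ 𝒜 i)
    (k : ℤ) (a : A) : degreeProj h.1 k (a * b) = degreeProj h.1 (k - i) a * b :=
  degreeProj_smul_of_mem h.1 h hb k a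

/-- A subspace is homogeneous if it contains the components of its elements. -/
def IsHomogeneousSubspace (h : DirectSum.IsInternal 𝒜) (V : Submodule K A) : Prop :=
  ∀ x ∈ V, ∀ i, degreeProj h i x ∈ V

lemma isHomogeneousSubspace_iSup {ι : Sort*} (h : DirectSum.IsInternal 𝒜)
    {V : ι → Submodule K A} (hV : ∀ i, IsHomogeneousSubspace h (V i)) :
    IsHomogeneousSubspace h (⨆ i, V i) := by
  intro x hx i
  exact (iSup_le fun j y hy => Submodule.mem_iSup_of_mem j (hV j y hy i) :
    ⨆ i, V i ≤ (⨆ i, V i).comap (degreeProj h i)) hx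

lemma isHomogeneousSubspace_of_le (h : DirectSum.IsInternal 𝒜) {V : Submodule K A} {i : ℤ}
    (hV : V ≤ 𝒜 i) : IsHomogeneousSubspace h V := by
  intro x hx j
  by_cases hij : i = j
  · subst hij
    rwa [degreeProj_of_mem h (hV hx)]
  · rw [degreeProj_of_mem_ne h (hV hx) hij]
    exact zero_mem _

lemma isHomogeneousSubspace_of_eq_iSup (h : DirectSum.IsInternal 𝒜) {V : Submodule K A}
    (hV : V = ⨆ i, V ⊓ 𝒜 i) : IsHomogeneousSubspace h V := by
  rw [hV]
  exact isHomogeneousSubspace_iSup h fun i => isHomogeneousSubspace_of_le h inf_le_right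

lemma isHomogeneousSubspace_mul (h : IsModuleGrading K A 𝒜 𝒜) {V W : Submodule K A}
    (hV : IsHomogeneousSubspace h.1 V) (hW : IsHomogeneousSubspace h.1 W) :
    IsHomogeneousSubspace h.1 (V * W) := by
  intro x hx k
  suffices V * W ≤ (V * W).comap (degreeProj h.1 k) from this hx
  refine Submodule.mul_le.2 fun v hv w hw => ?_
  obtain ⟨s, hs⟩ := exists_sum_degreeProj h.1 v
  rw [Submodule.mem_comap, hs, Finset.sum_mul, map_sum]
  refine sum_mem fun j _ => ?_
  rw [degreeProj_mul h (degreeProj_mem h.1 j v)]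
  exact Submodule.mul_mem_mul (hV v hv j) (hW w hw _)

/-- The part of a subspace supported in the degrees satisfying `s`. -/
def supportedPart (𝒜 : ℤ → Submodule K A) (s : ℤ → Prop) (V : Submodule K A) : Submodule K A :=
  ⨆ (i : ℤ) (_ : s i), V ⊓ 𝒜 i

lemma inf_le_supportedPart {s : ℤ → Prop} {V : Submodule K A} {i : ℤ} (hi : s i) :
    V ⊓ 𝒜 i ≤ supportedPart 𝒜 s V :=
  le_iSup₂_of_le i hi le_rfl

lemma isHomogeneousSubspace_supportedPart (h : DirectSum.IsInternal 𝒜) {s : ℤ → Prop}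
    {V : Submodule K A} : IsHomogeneousSubspace h (supportedPart 𝒜 s V) :=
  isHomogeneousSubspace_iSup h fun _ => isHomogeneousSubspace_iSup h fun _ =>
    isHomogeneousSubspace_of_le h inf_le_right

lemma subalgebra_mul_self (T : Subalgebra K A) :
    T.toSubmodule * T.toSubmodule = T.toSubmodule :=
  le_antisymm (Submodule.mul_le.2 fun _ ha _ hb => T.mul_mem ha hb) fun x hx => by
    simpa using Submodule.mul_mem_mul hx (show (1 : A) ∈ T.toSubmodule from T.one_mem)

lemma le_one_sup_supportedPart {C : Submodule K A} (hC : C = ⨆ i : ℤ, C ⊓ 𝒜 i)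
    (hC0 : C ⊓ 𝒜 0 = Submodule.span K {(1 : A)}) {s : ℤ → Prop}
    (hs : ∀ i, i ≠ 0 → ¬ s i → C ⊓ 𝒜 i = ⊥) : C ≤ 1 ⊔ supportedPart 𝒜 s C := by
  conv_lhs => rw [hC]
  refine iSup_le fun i => ?_
  by_cases hi : i = 0
  · subst hi
    rw [hC0, ← Submodule.one_eq_span]
    exact le_sup_left
  by_cases hsi : s i
  · exact (inf_le_supportedPart hsi).trans le_sup_right
  · rw [hs i hi hsi]
    exact bot_le

lemma supportedPart_mul_self_le (hmul : IsModuleGrading K A 𝒜 𝒜) {s : ℤ → Prop}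
    (hs : ∀ i j, s i → s j → s (i + j)) (C : Subalgebra K A) :
    supportedPart 𝒜 s C.toSubmodule * supportedPart 𝒜 s C.toSubmodule ≤
      supportedPart 𝒜 s C.toSubmodule := by
  conv_lhs => rw [supportedPart]
  simp only [Submodule.iSup_mul, Submodule.mul_iSup, iSup_le_iff]
  intro i hi j hj
  refine le_trans (Submodule.mul_le.2 fun a ha b hb => ?_) (inf_le_supportedPart (hs _ _ hi hj))
  exact ⟨C.mul_mem ha.1 hb.1, add_comm j i ▸ hmul.2 _ _ _ _ ha.2 hb.2⟩

lemma supportedPart_mul_le (hmul : IsModuleGrading K A 𝒜 𝒜) {s : ℤ → Prop}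
    {V W : Submodule K A} (hW : W ≤ 𝒜 0) : supportedPart 𝒜 s V * W ≤ supportedPart 𝒜 s (V * W) := by
  conv_lhs => rw [supportedPart]
  simp only [Submodule.iSup_mul, iSup_le_iff]
  intro i hi
  refine le_trans (Submodule.mul_le.2 fun a ha b hb => ?_) (inf_le_supportedPart hi)
  exact ⟨Submodule.mul_mem_mul ha.1 hb, by simpa using hmul.2 _ _ _ _ ha.2 (hW hb)⟩

lemma mul_supportedPart_le (hmul : IsModuleGrading K A 𝒜 𝒜) {s : ℤ → Prop}
    {V W : Submodule K A} (hW : W ≤ 𝒜 0) : W * supportedPart 𝒜 s V ≤ supportedPart 𝒜 s (W * V) := by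
  conv_lhs => rw [supportedPart]
  simp only [Submodule.mul_iSup, iSup_le_iff]
  intro i hi
  refine le_trans (Submodule.mul_le.2 fun a ha b hb => ?_) (inf_le_supportedPart hi)
  exact ⟨Submodule.mul_mem_mul ha hb.1, by simpa using hmul.2 _ _ _ _ (hW ha) hb.2⟩

lemma supportedPart_mul_eq (hmul : IsModuleGrading K A 𝒜 𝒜) {s : ℤ → Prop}
    {V W : Submodule K A} (hV : IsHomogeneousSubspace hmul.1 V) (hW : W ≤ 𝒜 0) :
    supportedPart 𝒜 s (V * W) = supportedPart 𝒜 s V * W := by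
  refine le_antisymm (iSup₂_le fun i hi x hx => ?_) (supportedPart_mul_le hmul hW)
  suffices V * W ≤ (supportedPart 𝒜 s V * W).comap (degreeProj hmul.1 i) by
    simpa [degreeProj_of_mem hmul.1 hx.2] using this hx.1
  refine Submodule.mul_le.2 fun a ha b hb => ?_
  rw [Submodule.mem_comap, degreeProj_mul_of_mem hmul (hW hb), sub_zero]
  exact Submodule.mul_mem_mul (inf_le_supportedPart hi ⟨hV a ha i, degreeProj_mem _ _ _⟩) hb

lemma mul_supportedPart_eq (hmul : IsModuleGrading K A 𝒜 𝒜) {s : ℤ → Prop}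
    {V W : Submodule K A} (hV : IsHomogeneousSubspace hmul.1 V) (hW : W ≤ 𝒜 0) :
    supportedPart 𝒜 s (W * V) = W * supportedPart 𝒜 s V := by
  refine le_antisymm (iSup₂_le fun i hi x hx => ?_) (mul_supportedPart_le hmul hW)
  suffices W * V ≤ (W * supportedPart 𝒜 s V).comap (degreeProj hmul.1 i) by
    simpa [degreeProj_of_mem hmul.1 hx.2] using this hx.1
  refine Submodule.mul_le.2 fun a ha b hb => ?_
  rw [Submodule.mem_comap, degreeProj_mul hmul (hW ha), sub_zero]
  exact Submodule.mul_mem_mul ha (inf_le_supportedPart hi ⟨hV b hb i, degreeProj_mem _ _ _⟩)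

end HomogeneousSubspaces

namespace TriangularDecomposition

variable {K A : Type u} [Field K] [Ring A] [Algebra K A] {𝒜 : ℤ → Submodule K A}
  {Am T Ap : Subalgebra K A}

lemma mul_mul_eq_top (h : TriangularDecomposition K A 𝒜 Am T Ap) :
    Am.toSubmodule * T.toSubmodule * Ap.toSubmodule = ⊤ := by
  refine eq_top_iff.2 fun x hx => ?_
  clear hx
  obtain ⟨z, rfl⟩ := h.mul_bij.2 x
  induction z using TensorProduct.induction_on with
  | zero => simp
  | add y z hy hz => rw [map_add]; exact add_mem hy hz
  | tmul w c =>
    induction w using TensorProduct.induction_on with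
    | zero => simp
    | add y z hy hz => rw [TensorProduct.add_tmul, map_add]; exact add_mem hy hz
    | tmul a t => exact Submodule.mul_mem_mul (Submodule.mul_mem_mul a.2 t.2) c.2

lemma inf_eq_bot_of_pos (h : TriangularDecomposition K A 𝒜 Am T Ap)
    {i : ℤ} (hi0 : i ≠ 0) (hi : ¬ 0 < i) : Ap.toSubmodule ⊓ 𝒜 i = ⊥ := by
  refine eq_bot_iff.2 fun x hx => ?_
  have : ⨆ n : ℕ, 𝒜 (n : ℤ) ≤ LinearMap.ker (degreeProj h.internal i) :=
    iSup_le fun n y hy => degreeProj_of_mem_ne h.internal hy (by omega)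
  rw [Submodule.mem_bot, ← degreeProj_of_mem h.internal hx.2]
  exact this (h.pos_supp hx.1)

lemma inf_eq_bot_of_neg (h : TriangularDecomposition K A 𝒜 Am T Ap)
    {i : ℤ} (hi0 : i ≠ 0) (hi : ¬ i < 0) : Am.toSubmodule ⊓ 𝒜 i = ⊥ := by
  refine eq_bot_iff.2 fun x hx => ?_
  have : ⨆ n : ℕ, 𝒜 (-(n : ℤ)) ≤ LinearMap.ker (degreeProj h.internal i) :=
    iSup_le fun n y hy => degreeProj_of_mem_ne h.internal hy (by omega)
  rw [Submodule.mem_bot, ← degreeProj_of_mem h.internal hx.2]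
  exact this (h.neg_supp hx.1)

lemma pos_le (h : TriangularDecomposition K A 𝒜 Am T Ap) :
    Ap.toSubmodule ≤ 1 ⊔ supportedPart 𝒜 (0 < ·) Ap.toSubmodule :=
  le_one_sup_supportedPart h.pos_graded h.pos_deg0 fun _ => h.inf_eq_bot_of_pos

lemma neg_le (h : TriangularDecomposition K A 𝒜 Am T Ap) :
    Am.toSubmodule ≤ 1 ⊔ supportedPart 𝒜 (· < 0) Am.toSubmodule :=
  le_one_sup_supportedPart h.neg_graded h.neg_deg0 fun _ => h.inf_eq_bot_of_neg

lemma pos_mul_le (h : TriangularDecomposition K A 𝒜 Am T Ap) :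
    Ap.toSubmodule * supportedPart 𝒜 (0 < ·) Ap.toSubmodule ≤
    supportedPart 𝒜 (0 < ·) Ap.toSubmodule := by
  refine (mul_le_mul_left h.pos_le _).trans ?_
  rw [Submodule.sup_mul, one_mul]
  exact sup_le le_rfl (supportedPart_mul_self_le h.isModuleGrading (fun _ _ => add_pos) _)

lemma neg_mul_le (h : TriangularDecomposition K A 𝒜 Am T Ap) :
    supportedPart 𝒜 (· < 0) Am.toSubmodule * Am.toSubmodule ≤
    supportedPart 𝒜 (· < 0) Am.toSubmodule := by
  refine (mul_le_mul_right h.neg_le _).trans ?_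
  rw [Submodule.mul_sup, mul_one]
  exact sup_le le_rfl (supportedPart_mul_self_le h.isModuleGrading (fun _ _ => add_neg) _)

lemma pos_homogeneous (h : TriangularDecomposition K A 𝒜 Am T Ap) :
    IsHomogeneousSubspace h.internal Ap.toSubmodule :=
  isHomogeneousSubspace_of_eq_iSup h.internal h.pos_graded

lemma neg_homogeneous (h : TriangularDecomposition K A 𝒜 Am T Ap) :
    IsHomogeneousSubspace h.internal Am.toSubmodule :=
  isHomogeneousSubspace_of_eq_iSup h.internal h.neg_graded

lemma Bpos_homogeneous (h : TriangularDecomposition K A 𝒜 Am T Ap) :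
    IsHomogeneousSubspace h.internal (Bpos K A T Ap) :=
  isHomogeneousSubspace_mul h.isModuleGrading h.pos_homogeneous
    (isHomogeneousSubspace_of_le h.internal h.T_deg0)

lemma Bneg_homogeneous (h : TriangularDecomposition K A 𝒜 Am T Ap) :
    IsHomogeneousSubspace h.internal (Bneg K A Am T) :=
  isHomogeneousSubspace_mul h.isModuleGrading h.neg_homogeneous
    (isHomogeneousSubspace_of_le h.internal h.T_deg0)

lemma Jpos_eq (h : TriangularDecomposition K A 𝒜 Am T Ap) :
    Jpos K A 𝒜 T Ap = T.toSubmodule * supportedPart 𝒜 (0 < ·) Ap.toSubmodule := by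
  rw [← mul_supportedPart_eq h.isModuleGrading h.pos_homogeneous h.T_deg0, ← h.comm_pos]
  rfl

lemma Jpos_eq' (h : TriangularDecomposition K A 𝒜 Am T Ap) :
    Jpos K A 𝒜 T Ap = supportedPart 𝒜 (0 < ·) Ap.toSubmodule * T.toSubmodule := by
  rw [← supportedPart_mul_eq h.isModuleGrading h.pos_homogeneous h.T_deg0]
  rfl

lemma Jneg_eq (h : TriangularDecomposition K A 𝒜 Am T Ap) :
    Jneg K A 𝒜 Am T = supportedPart 𝒜 (· < 0) Am.toSubmodule * T.toSubmodule := by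
  rw [← supportedPart_mul_eq h.isModuleGrading h.neg_homogeneous h.T_deg0]
  rfl

lemma Jneg_eq' (h : TriangularDecomposition K A 𝒜 Am T Ap) :
    Jneg K A 𝒜 Am T = T.toSubmodule * supportedPart 𝒜 (· < 0) Am.toSubmodule := by
  rw [← mul_supportedPart_eq h.isModuleGrading h.neg_homogeneous h.T_deg0, ← h.comm_neg]
  rfl

lemma Jpos_mul (h : TriangularDecomposition K A 𝒜 Am T Ap) :
    Jpos K A 𝒜 T Ap * T.toSubmodule = Jpos K A 𝒜 T Ap := by
  rw [h.Jpos_eq', mul_assoc, subalgebra_mul_self]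

lemma mul_Jneg (h : TriangularDecomposition K A 𝒜 Am T Ap) :
    T.toSubmodule * Jneg K A 𝒜 Am T = Jneg K A 𝒜 Am T := by
  rw [h.Jneg_eq', ← mul_assoc, subalgebra_mul_self]

lemma top_mul_Jpos (h : TriangularDecomposition K A 𝒜 Am T Ap) : ⊤ * Jpos K A 𝒜 T Ap =
    Am.toSubmodule * T.toSubmodule * supportedPart 𝒜 (0 < ·) Ap.toSubmodule := by
  refine le_antisymm ?_ ?_
  · rw [h.Jpos_eq, ← h.mul_mul_eq_top]
    calc _ = Am.toSubmodule * T.toSubmodule * (Ap.toSubmodule * T.toSubmodule) *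
          supportedPart 𝒜 (0 < ·) Ap.toSubmodule := by simp only [mul_assoc]
      _ = Am.toSubmodule * (T.toSubmodule * T.toSubmodule) * (Ap.toSubmodule *
          supportedPart 𝒜 (0 < ·) Ap.toSubmodule) := by
        rw [h.comm_pos]; simp only [mul_assoc]
      _ ≤ _ := by
        rw [subalgebra_mul_self]
        exact mul_le_mul_right h.pos_mul_le _
  · rw [h.Jpos_eq, mul_assoc]
    exact mul_le_mul_left le_top _

lemma Jneg_mul_top (h : TriangularDecomposition K A 𝒜 Am T Ap) : Jneg K A 𝒜 Am T * ⊤ =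
    supportedPart 𝒜 (· < 0) Am.toSubmodule * T.toSubmodule * Ap.toSubmodule := by
  refine le_antisymm ?_ ?_
  · rw [h.Jneg_eq, ← h.mul_mul_eq_top]
    calc _ = supportedPart 𝒜 (· < 0) Am.toSubmodule * (T.toSubmodule * Am.toSubmodule) *
          T.toSubmodule * Ap.toSubmodule := by simp only [mul_assoc]
      _ = (supportedPart 𝒜 (· < 0) Am.toSubmodule * Am.toSubmodule) *
          (T.toSubmodule * T.toSubmodule) * Ap.toSubmodule := by
        rw [← h.comm_neg]; simp only [mul_assoc]
      _ ≤ _ := by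
        rw [subalgebra_mul_self]
        exact mul_le_mul_left (mul_le_mul_left h.neg_mul_le _) _
  · rw [h.Jneg_eq]
    exact mul_le_mul_right le_top _

lemma Bneg_sup_eq_top (h : TriangularDecomposition K A 𝒜 Am T Ap) :
    Bneg K A Am T ⊔ ⊤ * Jpos K A 𝒜 T Ap = ⊤ := by
  rw [eq_top_iff, h.top_mul_Jpos, ← h.mul_mul_eq_top]
  refine (mul_le_mul_right h.pos_le _).trans ?_
  rw [Submodule.mul_sup, mul_one, Bneg]

lemma Bpos_sup_eq_top (h : TriangularDecomposition K A 𝒜 Am T Ap) :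
    Bpos K A T Ap ⊔ Jneg K A 𝒜 Am T * ⊤ = ⊤ := by
  rw [eq_top_iff, h.Jneg_mul_top, ← h.mul_mul_eq_top, Bpos, h.comm_pos, mul_assoc, mul_assoc]
  refine (mul_le_mul_left h.neg_le _).trans ?_
  rw [Submodule.sup_mul, one_mul]

lemma Bneg_inf_eq_bot (h : TriangularDecomposition K A 𝒜 Am T Ap) :
    Bneg K A Am T ⊓ ⊤ * Jpos K A 𝒜 T Ap = ⊥ := by
  let π : ↥Ap.toSubmodule →ₗ[K] ↥Ap.toSubmodule :=
    (degreeProj h.internal 0).restrict fun x hx => h.pos_homogeneous x hx 0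
  let E : A →ₗ[K] A := triMulMap K A Am.toSubmodule T.toSubmodule Ap.toSubmodule ∘ₗ
    TensorProduct.map LinearMap.id π ∘ₗ (LinearEquiv.ofBijective _ h.mul_bij).symm.toLinearMap
  have hE : ∀ a ∈ Am, ∀ t ∈ T, ∀ c ∈ Ap, E (a * t * c) = a * t * degreeProj h.internal 0 c := by
    intro a ha t ht c hc
    have : (LinearEquiv.ofBijective _ h.mul_bij).symm (a * t * c) =
        ((⟨a, ha⟩ : ↥Am.toSubmodule) ⊗ₜ[K] (⟨t, ht⟩ : ↥T.toSubmodule)) ⊗ₜ[K]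
          (⟨c, hc⟩ : ↥Ap.toSubmodule) := by
      rw [LinearEquiv.symm_apply_eq]; rfl
    simp only [E, LinearMap.comp_apply, LinearEquiv.coe_coe, this]
    rfl
  have h1 : Bneg K A Am T ≤ LinearMap.eqLocus E LinearMap.id := Submodule.mul_le.2
    fun a ha t ht => by
      have := hE a ha t ht 1 Ap.one_mem
      rw [degreeProj_of_mem h.internal h.one_mem, mul_one] at this
      exact this
  have h2 : ⊤ * Jpos K A 𝒜 T Ap ≤ LinearMap.ker E := by
    rw [h.top_mul_Jpos, supportedPart]
    simp only [Submodule.mul_iSup, iSup_le_iff]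
    refine fun i hi => Submodule.mul_le.2 fun b hb c hc => ?_
    refine Submodule.mul_induction_on hb (fun a ha t ht => ?_) fun x y hx hy => ?_
    · rw [LinearMap.mem_ker, hE a ha t ht c hc.1,
        degreeProj_of_mem_ne h.internal hc.2 hi.ne', mul_zero]
    · rw [add_mul]; exact add_mem hx hy
  exact eq_bot_iff.2 fun x hx => (h1 hx.1).symm.trans (h2 hx.2)

lemma Bpos_inf_eq_bot (h : TriangularDecomposition K A 𝒜 Am T Ap) :
    Bpos K A T Ap ⊓ Jneg K A 𝒜 Am T * ⊤ = ⊥ := by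
  let π : ↥Am.toSubmodule →ₗ[K] ↥Am.toSubmodule :=
    (degreeProj h.internal 0).restrict fun x hx => h.neg_homogeneous x hx 0
  let E : A →ₗ[K] A := triMulMap K A Am.toSubmodule T.toSubmodule Ap.toSubmodule ∘ₗ
    TensorProduct.map (TensorProduct.map π LinearMap.id) LinearMap.id ∘ₗ
      (LinearEquiv.ofBijective _ h.mul_bij).symm.toLinearMap
  have hE : ∀ a ∈ Am, ∀ t ∈ T, ∀ c ∈ Ap, E (a * t * c) = degreeProj h.internal 0 a * t * c := by
    intro a ha t ht c hc
    have : (LinearEquiv.ofBijective _ h.mul_bij).symm (a * t * c) =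
        ((⟨a, ha⟩ : ↥Am.toSubmodule) ⊗ₜ[K] (⟨t, ht⟩ : ↥T.toSubmodule)) ⊗ₜ[K]
          (⟨c, hc⟩ : ↥Ap.toSubmodule) := by
      rw [LinearEquiv.symm_apply_eq]; rfl
    simp only [E, LinearMap.comp_apply, LinearEquiv.coe_coe, this]
    rfl
  have h1 : Bpos K A T Ap ≤ LinearMap.eqLocus E LinearMap.id := by
    rw [Bpos, h.comm_pos]
    refine Submodule.mul_le.2 fun t ht c hc => ?_
    have := hE 1 Am.one_mem t ht c hc
    rw [degreeProj_of_mem h.internal h.one_mem, one_mul] at this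
    exact this
  have h2 : Jneg K A 𝒜 Am T * ⊤ ≤ LinearMap.ker E := by
    rw [h.Jneg_mul_top, supportedPart]
    simp only [Submodule.iSup_mul, iSup_le_iff]
    refine fun i hi => Submodule.mul_le.2 fun b hb c hc => ?_
    refine Submodule.mul_induction_on hb (fun a ha t ht => ?_) fun x y hx hy => ?_
    · rw [LinearMap.mem_ker, hE a ha.1 t ht c hc,
        degreeProj_of_mem_ne h.internal ha.2 hi.ne, zero_mul, zero_mul]
    · rw [add_mul]; exact add_mem hx hy
  exact eq_bot_iff.2 fun x hx => (h1 hx.1).symm.trans (h2 hx.2)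

lemma exists_sub_mem_of_degree_zero (h : TriangularDecomposition K A 𝒜 Am T Ap)
    {a : A} (ha : a ∈ 𝒜 0) :
    ∃ t ∈ T, a - t ∈ ⊤ * Jpos K A 𝒜 T Ap := by
  obtain ⟨b, hb, c, hc, hbc⟩ := Submodule.mem_sup.1
    (h.Bneg_sup_eq_top.ge (Submodule.mem_top (x := a)))
  have hJ : IsHomogeneousSubspace h.internal (⊤ * Jpos K A 𝒜 T Ap) :=
    isHomogeneousSubspace_mul h.isModuleGrading (fun _ _ _ => Submodule.mem_top)
      (isHomogeneousSubspace_supportedPart h.internal)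
  have hB : Bneg K A Am T ≤ T.toSubmodule.comap (degreeProj h.internal 0) := by
    refine Submodule.mul_le.2 fun x hx t ht => ?_
    rw [Submodule.mem_comap, degreeProj_mul_of_mem h.isModuleGrading (h.T_deg0 ht), sub_zero]
    have : degreeProj h.internal 0 x ∈ Submodule.span K {(1 : A)} :=
      h.neg_deg0 ▸ ⟨h.neg_homogeneous x hx 0, degreeProj_mem _ _ _⟩
    obtain ⟨k, hk⟩ := Submodule.mem_span_singleton.1 this
    rw [← hk, smul_mul_assoc, one_mul]
    exact T.smul_mem ht k
  refine ⟨_, hB hb, ?_⟩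
  have : a - degreeProj h.internal 0 b = degreeProj h.internal 0 c := by
    rw [← degreeProj_of_mem h.internal ha, ← hbc, map_add]
    simp
  rw [this]
  exact hJ c hc 0

end TriangularDecomposition

end TriangularPaper

namespace TriangularPaper

section PrimitiveIdempotents

variable {R V : Type*} [Ring R] [AddCommGroup V] [Module R V]

/-- An idempotent generating a simple left ideal. -/
def IsPrimitiveIdem (e : R) : Prop :=
  IsIdempotentElem e ∧ IsSimpleModule R (Ideal.span {e})

lemma IsPrimitiveIdem.mul_eq_zero {e : R} (he : IsPrimitiveIdem e) {P : Submodule R V} {x : V}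
    (hx : x ∉ P) (hex : e • x = x) {t : R} (ht : t • x ∈ P) : t * e = 0 := by
  have := he.2
  let g : Ideal.span {e} →ₗ[R] V ⧸ P :=
    P.mkQ ∘ₗ LinearMap.toSpanSingleton R V x ∘ₗ (Ideal.span {e}).subtype
  rcases LinearMap.injective_or_eq_zero g with hg | hg
  · have hmem : t * e ∈ Ideal.span {e} := Ideal.mem_span_singleton'.2 ⟨t, rfl⟩
    have h0 : g ⟨t * e, hmem⟩ = g 0 := by
      rw [map_zero]
      refine (Submodule.Quotient.mk_eq_zero P).2 ?_
      simpa [mul_smul, hex] using ht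
    exact congrArg Subtype.val (hg h0)
  · refine absurd ?_ hx
    have h0 := LinearMap.congr_fun hg ⟨e, Ideal.mem_span_singleton_self e⟩
    rw [← hex]
    exact (Submodule.Quotient.mk_eq_zero P).1 h0

lemma exists_isPrimitiveIdem [IsSemisimpleRing R] {P : Submodule R V} {x : V} (hx : x ∉ P) :
    ∃ e : R, IsPrimitiveIdem e ∧ e • x ∉ P := by
  by_contra! hcon
  refine hx ?_
  let I : Ideal R := P.comap (LinearMap.toSpanSingleton R V x)
  have hI : sSup {m : Submodule R R | IsSimpleModule R m} ≤ I := by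
    refine sSup_le fun S hS => ?_
    obtain ⟨e, he, rfl⟩ := IsSemisimpleRing.ideal_eq_span_idempotent S
    exact Ideal.span_le.2 (Set.singleton_subset_iff.2 (hcon e ⟨he, hS⟩))
  rw [IsSemisimpleModule.sSup_simples_eq_top] at hI
  simpa [I] using hI (Submodule.mem_top (x := (1 : R)))

lemma IsPrimitiveIdem.exists_linearMap {e : R} (he : IsPrimitiveIdem e) {M : Type*}
    [AddCommGroup M] [Module R M] [IsSimpleModule R M] {m : M} (hm : m ≠ 0) (hem : e • m = m)
    {v : V} (hev : e • v = v) : ∃ l : M →ₗ[R] V, l m = v := by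
  have hsurj : Function.Surjective (LinearMap.toSpanSingleton R M m) :=
    IsSimpleModule.toSpanSingleton_surjective R hm
  let g := LinearMap.quotKerEquivOfSurjective _ hsurj
  have hker : LinearMap.ker (LinearMap.toSpanSingleton R M m) ≤
      LinearMap.ker (LinearMap.toSpanSingleton R V v) := by
    intro t ht
    have : t * e = 0 := he.mul_eq_zero (P := (⊥ : Submodule R M)) (by simpa using hm) hem
      (by simpa using ht)
    rw [LinearMap.mem_ker, LinearMap.toSpanSingleton_apply, ← hev, ← mul_smul, this, zero_smul]
  refine ⟨Submodule.liftQ _ _ hker ∘ₗ g.symm.toLinearMap, ?_⟩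
  have : g.symm m = Submodule.Quotient.mk 1 := by
    rw [LinearEquiv.symm_apply_eq]
    simp [g]
  simp [this]

lemma IsPrimitiveIdem.exists_linearMap_to [IsSemisimpleRing R] {e : R} (he : IsPrimitiveIdem e)
    {M : Type*} [AddCommGroup M] [Module R M] [IsSimpleModule R M] {m : M} (hm : m ≠ 0)
    (hem : e • m = m) {v : V} (hv : v ≠ 0) (hev : e • v = v) : ∃ l : V →ₗ[R] M, l v = m := by
  obtain ⟨l, hl⟩ := he.exists_linearMap hm hem hev
  have hinj : Function.Injective l := (LinearMap.injective_or_eq_zero l).resolve_right fun h0 =>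
    hv (by rw [← hl, h0, LinearMap.zero_apply])
  obtain ⟨r, hr⟩ := IsSemisimpleModule.extension_property l hinj LinearMap.id
  exact ⟨r, by rw [← hl, ← LinearMap.comp_apply, hr, LinearMap.id_apply]⟩

end PrimitiveIdempotents

/-- Two finite families of characters with equal sums, whose members are determined by their
highest terms, agree up to a bijection. -/
lemma exists_matching {C : Type*} : ∀ {n m : ℕ} (a : Fin n → ℤ → C → ℕ) (b : Fin m → ℤ → C → ℕ)
    (R : Fin n → Fin m → Prop) (ta : Fin n → ℤ) (tb : Fin m → ℤ)
    (_ : ∀ k, ∃ c, a k (ta k) c ≠ 0) (_ : ∀ k, ∃ c, b k (tb k) c ≠ 0)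
    (_ : ∀ k j c, a k j c ≠ 0 → j ≤ ta k) (_ : ∀ k j c, b k j c ≠ 0 → j ≤ tb k)
    (_ : ∀ k l c, ta k = tb l → a k (ta k) c ≠ 0 → b l (ta k) c ≠ 0 → R k l ∧ a k = b l)
    (_ : ∀ j c, ∑ k, a k j c = ∑ l, b l j c), ∃ σ : Fin n ≃ Fin m, ∀ k, R k (σ k) := by
  intro n
  induction n with
  | zero =>
    intro m a b R ta tb ha hb ha' hb' hR hsum
    rcases m with _ | m
    · exact ⟨Equiv.refl _, fun k => k.elim0⟩
    · obtain ⟨c, hc⟩ := hb 0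
      have := hsum (tb 0) c
      rw [Finset.univ_eq_empty, Finset.sum_empty, eq_comm, Finset.sum_eq_zero_iff] at this
      exact absurd (this 0 (Finset.mem_univ _)) hc
  | succ n ih =>
    intro m a b R ta tb ha hb ha' hb' hR hsum
    have hab : ∀ k, ∃ l c, a k (ta k) c ≠ 0 ∧ b l (ta k) c ≠ 0 := by
      intro k
      obtain ⟨c, hc⟩ := ha k
      by_contra! hcon
      have := hsum (ta k) c
      rw [Finset.sum_eq_zero fun l _ => hcon l c hc, Finset.sum_eq_zero_iff] at this
      exact hc (this k (Finset.mem_univ _))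
    have hba : ∀ l, ∃ k, tb l ≤ ta k := by
      intro l
      obtain ⟨c, hc⟩ := hb l
      by_contra! hcon
      have := hsum (tb l) c
      rw [Finset.sum_eq_zero fun k _ => by_contra fun hk => absurd (ha' k _ _ hk)
        (not_le.2 (hcon k)), eq_comm, Finset.sum_eq_zero_iff] at this
      exact hc (this l (Finset.mem_univ _))
    obtain ⟨k, hk⟩ := Finite.exists_max ta
    obtain ⟨l, c, hac, hbc⟩ := hab k
    obtain ⟨k', hk'⟩ := hba l
    obtain ⟨hRkl, hkl⟩ := hR k l c (le_antisymm (hb' _ _ _ hbc) (hk'.trans (hk k'))) hac hbc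
    rcases m with _ | m
    · exact l.elim0
    obtain ⟨σ, hσ⟩ := ih (fun i => a (k.succAbove i)) (fun i => b (l.succAbove i))
      (fun i j => R (k.succAbove i) (l.succAbove j)) (fun i => ta (k.succAbove i))
      (fun i => tb (l.succAbove i)) (fun i => ha _) (fun i => hb _) (fun i => ha' _)
      (fun i => hb' _) (fun i j => hR _ _) fun j c => by
        have := hsum j c
        rwa [Fin.sum_univ_succAbove _ k, Fin.sum_univ_succAbove _ l, hkl, add_right_inj] at this
    refine ⟨(finSuccEquiv' k).trans ((Equiv.optionCongr σ).trans (finSuccEquiv' l).symm),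
      fun i => ?_⟩
    rcases Fin.eq_self_or_eq_succAbove k i with rfl | ⟨i, rfl⟩
    · simpa using hRkl
    · simpa using hσ i

section Sections

variable {K A : Type u} [Field K] [Ring A] [Algebra K A] {𝒜 : ℤ → Submodule K A}
  {Am T Ap : Subalgebra K A}
  {X : Type u} [AddCommGroup X] [Module A X] [Module K X] [IsScalarTower K A X]
  {ℳ : ℤ → Submodule K X}
  {Y : Type u} [AddCommGroup Y] [Module A Y] [Module K Y] [IsScalarTower K A Y]
  {𝒩 : ℤ → Submodule K Y}

lemma smul_mem_of_mem_top_mul_Jpos (hX : IsModuleGrading K A 𝒜 ℳ) {P Q : Submodule A X} {i : ℤ}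
    (hi : IsTopDegree ℳ P Q i) {x : X} (hx : x ∈ ℳ i) (hxQ : x ∈ Q) {c : A}
    (hc : c ∈ ⊤ * Jpos K A 𝒜 T Ap) : c • x ∈ P := by
  suffices ⊤ * Jpos K A 𝒜 T Ap ≤ (P.comap (LinearMap.toSpanSingleton A X x)).restrictScalars K
    from this hc
  refine Submodule.mul_le.2 fun a _ j hj => ?_
  suffices Jpos K A 𝒜 T Ap ≤ (P.comap (LinearMap.toSpanSingleton A X x)).restrictScalars K
    from Submodule.smul_mem _ a (this hj)
  exact iSup₂_le fun k hk b hb =>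
    hi (k + i) (by omega) _ (Q.smul_mem b hxQ) (hX.2 _ _ _ _ hb.2 hx)

lemma smul_mem_of_smul_mem (h : TriangularDecomposition K A 𝒜 Am T Ap)
    (hX : IsModuleGrading K A 𝒜 ℳ) (hY : IsModuleGrading K A 𝒜 𝒩)
    {P Q : GradedSub A hX.1} {P' Q' : GradedSub A hY.1} (hPQ' : P' ⋖ Q')
    {i : ℤ} (hi : IsTopDegree ℳ P.1 Q.1 i) (hi' : IsTopDegree 𝒩 P'.1 Q'.1 i)
    {e : T} (he : IsPrimitiveIdem e)
    {x : X} (hxQ : x ∈ Q.1) (hx : x ∈ ℳ i) (hxP : x ∉ P.1) (hex : (e : A) • x = x)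
    {y : Y} (hyQ : y ∈ Q'.1) (hy : y ∈ 𝒩 i) (hyP : y ∉ P'.1) (hey : (e : A) • y = y)
    {a : A} (ha : a • x ∈ P.1) : a • y ∈ P'.1 := by
  rw [smul_mem_iff_forall_degreeProj h.internal hX P.2 hx] at ha
  rw [smul_mem_iff_forall_degreeProj h.internal hY P'.2 hy]
  intro j
  by_contra hay
  have haj := degreeProj_mem h.internal j a
  obtain ⟨b, hb, hby⟩ := exists_homogeneous_smul_of_covBy h.internal hY hPQ'
    (hY.2 _ _ _ _ haj hy) (Q'.1.smul_mem _ hyQ) hay hyQ hy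
  rw [← mul_smul] at hby
  have hba : b * degreeProj h.internal j a ∈ 𝒜 0 := by
    simpa using h.mul_mem _ _ _ _ hb haj
  obtain ⟨t, ht, htc⟩ := h.exists_sub_mem_of_degree_zero hba
  have hcy := smul_mem_of_mem_top_mul_Jpos hY hi' hy hyQ htc
  have hcx := smul_mem_of_mem_top_mul_Jpos hX hi hx hxQ htc
  have hty : (1 - ⟨t, ht⟩ : T) • y ∈ P'.1.restrictScalars T := by
    have : (1 - ⟨t, ht⟩ : T) • y = (y - (b * degreeProj h.internal j a) • y) +
        (b * degreeProj h.internal j a - t) • y := by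
      rw [sub_smul, sub_smul, one_smul, Subalgebra.smul_def]
      abel
    rw [this]
    exact P'.1.add_mem hby hcy
  have hte := he.mul_eq_zero (P := P'.1.restrictScalars T) hyP hey hty
  have htx : t • x = x := by
    have : (1 - ⟨t, ht⟩ : T) • x = 0 := by
      rw [← hex, ← Subalgebra.smul_def, ← mul_smul, hte, zero_smul]
    rw [sub_smul, one_smul, sub_eq_zero, Subalgebra.smul_def] at this
    exact this.symm
  refine hxP ?_
  rw [sub_smul, htx, mul_smul] at hcx
  simpa using P.1.sub_mem (P.1.smul_mem b (ha j)) hcx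

lemma sectionMult_eq_of_ann [FiniteDimensional K A] (h𝒜 : DirectSum.IsInternal 𝒜)
    (h𝒜0 : ∀ e ∈ T, e ∈ 𝒜 0) (hmul : IsModuleGrading K A 𝒜 𝒜)
    (hX : IsModuleGrading K A 𝒜 ℳ) {P Q : GradedSub A hX.1} (hPQ : P ⋖ Q) {i : ℤ} {x : X}
    (hxQ : x ∈ Q.1) (hx : x ∈ ℳ i) (hxP : x ∉ P.1) {e : A} (heT : e ∈ T)
    (he : IsIdempotentElem e) (k : ℤ) :
    sectionMult ℳ P.1 Q.1 e k + Module.finrank K ↥(weightSpace 𝒜 e (k - i) ⊤ ⊓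
      (P.1.comap (LinearMap.toSpanSingleton A X x)).restrictScalars K) =
    Module.finrank K (weightSpace 𝒜 e (k - i) (⊤ : Submodule A A)) := by
  let g : A →ₗ[K] X ⧸ P.1 := (P.1.mkQ ∘ₗ LinearMap.toSpanSingleton A X x).restrictScalars K
  have hg : (P.1.comap (LinearMap.toSpanSingleton A X x)).restrictScalars K = LinearMap.ker g := by
    ext a
    exact (Submodule.Quotient.mk_eq_zero P.1).symm
  have hmap : (weightSpace ℳ e k Q.1).map (P.1.mkQ.restrictScalars K) =
      (weightSpace 𝒜 e (k - i) (⊤ : Submodule A A)).map g := by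
    refine le_antisymm ?_ ?_
    · rintro _ ⟨q, ⟨⟨hq, hqk⟩, heq⟩, rfl⟩
      obtain ⟨a, ha, haq⟩ := exists_homogeneous_smul_of_covBy h𝒜 hX hPQ hx hxQ hxP hq hqk
      refine ⟨e * a, ⟨⟨Submodule.mem_top, ?_⟩, ?_⟩, ?_⟩
      · simpa using hmul.2 _ _ _ _ (h𝒜0 e heT) ha
      · change e * (e * a) = e * a
        rw [← mul_assoc, he.eq]
      · refine ((Submodule.Quotient.eq P.1).2 ?_).symm
        have := P.1.smul_mem e haq
        rw [smul_sub, show e • q = q from heq, ← mul_smul] at this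
        exact this
    · rintro _ ⟨a, ⟨⟨-, hak⟩, hea⟩, rfl⟩
      refine ⟨a • x, ⟨⟨Q.1.smul_mem a hxQ, ?_⟩, ?_⟩, rfl⟩
      · simpa using hX.2 _ _ _ _ hak hx
      · change e • a • x = a • x
        rw [← mul_smul, show e * a = a from hea]
  rw [sectionMult, hmap, hg, finrank_map_add_finrank_inf_ker]

lemma exists_section_equiv {P Q : Submodule A X} {P' Q' : Submodule A Y} {x : X} {y : Y}
    (hxQ : x ∈ Q) (hyQ : y ∈ Q') (hx : ∀ q ∈ Q, ∃ a : A, q - a • x ∈ P)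
    (hy : ∀ q ∈ Q', ∃ a : A, q - a • y ∈ P') (hxy : ∀ a : A, a • x ∈ P ↔ a • y ∈ P') :
    ∃ f : (↥Q ⧸ Submodule.comap Q.subtype P) ≃ₗ[A] (↥Q' ⧸ Submodule.comap Q'.subtype P'),
      ∀ a : A, f (Submodule.Quotient.mk (a • ⟨x, hxQ⟩)) =
        Submodule.Quotient.mk (a • ⟨y, hyQ⟩) := by
  let gx := (Submodule.comap Q.subtype P).mkQ ∘ₗ LinearMap.toSpanSingleton A Q ⟨x, hxQ⟩
  let gy := (Submodule.comap Q'.subtype P').mkQ ∘ₗ LinearMap.toSpanSingleton A Q' ⟨y, hyQ⟩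
  have hgx : Function.Surjective gx := by
    intro z
    obtain ⟨⟨q, hq⟩, rfl⟩ := Submodule.mkQ_surjective _ z
    obtain ⟨a, ha⟩ := hx q hq
    exact ⟨a, ((Submodule.Quotient.eq (Submodule.comap Q.subtype P)).2 ha).symm⟩
  have hgy : Function.Surjective gy := by
    intro z
    obtain ⟨⟨q, hq⟩, rfl⟩ := Submodule.mkQ_surjective _ z
    obtain ⟨a, ha⟩ := hy q hq
    exact ⟨a, ((Submodule.Quotient.eq (Submodule.comap Q'.subtype P')).2 ha).symm⟩
  have hker : LinearMap.ker gx = LinearMap.ker gy := by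
    ext a
    exact ((Submodule.Quotient.mk_eq_zero (Submodule.comap Q.subtype P)).trans (hxy a)).trans
      (Submodule.Quotient.mk_eq_zero (Submodule.comap Q'.subtype P')).symm
  refine ⟨(gx.quotKerEquivOfSurjective hgx).symm ≪≫ₗ Submodule.quotEquivOfEq _ _ hker ≪≫ₗ
    gy.quotKerEquivOfSurjective hgy, fun a => ?_⟩
  have : (gx.quotKerEquivOfSurjective hgx).symm (Submodule.Quotient.mk (a • ⟨x, hxQ⟩)) =
      Submodule.Quotient.mk a := by
    rw [LinearEquiv.symm_apply_eq]
    rfl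
  simp only [LinearEquiv.trans_apply, this]
  rfl

lemma factorPiece_eq (h𝒜 : DirectSum.IsInternal 𝒜) (hX : IsModuleGrading K A 𝒜 ℳ)
    {P Q : GradedSub A hX.1} (hPQ : P ⋖ Q) {i : ℤ} {x : X} (hxQ : x ∈ Q.1) (hx : x ∈ ℳ i)
    (hxP : x ∉ P.1) (k : ℤ) : factorPiece K A ℳ P.1 Q.1 k =
      (fun a : A => Submodule.Quotient.mk (a • (⟨x, hxQ⟩ : Q.1))) '' 𝒜 (k - i) := by
  refine Set.Subset.antisymm ?_ ?_
  · rintro _ ⟨⟨q, hq⟩, hqk, rfl⟩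
    obtain ⟨a, ha, haq⟩ := exists_homogeneous_smul_of_covBy h𝒜 hX hPQ hx hxQ hxP hq hqk
    exact ⟨a, ha, ((Submodule.Quotient.eq (Submodule.comap Q.1.subtype P.1)).2 haq).symm⟩
  · rintro _ ⟨a, ha, rfl⟩
    exact ⟨a • ⟨x, hxQ⟩, by simpa using hX.2 _ _ _ _ ha hx, rfl⟩

lemma sum_sectionMult [FiniteDimensional K X] {hX : DirectSum.IsInternal ℳ}
    {F : ℕ → GradedSub A hX} (n : ℕ) (h0 : (F 0).1 = ⊥) (hF : ∀ i < n, F i ⋖ F (i + 1)) (e : A)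
    (j : ℤ) : ∑ k : Fin n, sectionMult ℳ (F k).1 (F (k + 1)).1 e j =
      Module.finrank K (weightSpace ℳ e j (F n).1) := by
  induction n with
  | zero =>
    have : weightSpace ℳ e j (F 0).1 = ⊥ := by
      rw [h0]
      exact eq_bot_iff.2 fun x hx => hx.1.1
    rw [Finset.univ_eq_empty, Finset.sum_empty, this, finrank_bot]
  | succ n ih =>
    rw [Fin.sum_univ_castSucc, ← sectionMult_add (hF n n.lt_succ_self).le, add_comm]
    simp only [Fin.val_castSucc, Fin.val_last]
    rw [ih fun i hi => hF i (hi.trans n.lt_succ_self)]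

/-- Injectivity of the character map: finite-dimensional graded modules with the same weight
multiplicities have the same graded composition factors. -/
theorem gradedMatchingFactors_of_finrank_eq [FiniteDimensional K A]
    (h : TriangularDecomposition K A 𝒜 Am T Ap) [IsSemisimpleRing T]
    [FiniteDimensional K X] [FiniteDimensional K Y]
    (hX : IsModuleGrading K A 𝒜 ℳ) (hY : IsModuleGrading K A 𝒜 𝒩)
    (hXY : ∀ e : T, IsPrimitiveIdem e → ∀ j, Module.finrank K (weightSpace ℳ (e : A) j ⊤) =
      Module.finrank K (weightSpace 𝒩 (e : A) j ⊤)) : GradedMatchingFactors K A ℳ 𝒩 := by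
  obtain ⟨n, F, hF0, hFn, hF⟩ := exists_gradedSub_chain (A := A) hX.1
  obtain ⟨m, G, hG0, hGm, hG⟩ := exists_gradedSub_chain (A := A) hY.1
  choose ta hta hta' using fun k : Fin n => exists_isTopDegree hX.1 (hF k k.2).lt
  choose tb htb htb' using fun k : Fin m => exists_isTopDegree hY.1 (hG k k.2).lt
  let C := {e : T // IsPrimitiveIdem e}
  have hT0 : ∀ t ∈ T, t ∈ 𝒜 0 := fun t ht => h.T_deg0 ht
  obtain ⟨σ, hσ⟩ := exists_matching (C := C)
    (fun k j e => sectionMult ℳ (F k).1 (F (k + 1)).1 (e.1 : A) j)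
    (fun k j e => sectionMult 𝒩 (G k).1 (G (k + 1)).1 (e.1 : A) j)
    (fun k l => ∃ f : (↥(F (k + 1)).1 ⧸ Submodule.comap (F (k + 1)).1.subtype (F k).1) ≃ₗ[A]
        (↥(G (l + 1)).1 ⧸ Submodule.comap (G (l + 1)).1.subtype (G l).1),
      ∀ i : ℤ, f '' factorPiece K A ℳ (F k).1 (F (k + 1)).1 i =
        factorPiece K A 𝒩 (G l).1 (G (l + 1)).1 i) ta tb
    (fun k => by
      obtain ⟨x, hxQ, hx, hxP⟩ := hta k
      obtain ⟨e, he, hex⟩ := exists_isPrimitiveIdem (R := T)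
        (P := (F k).1.restrictScalars T) hxP
      refine ⟨⟨e, he⟩, sectionMult_ne_zero_iff.2 ⟨e • x, (F (k + 1)).1.smul_mem _ hxQ, ?_, ?_, hex⟩⟩
      · have := hX.2 _ _ _ _ (hT0 _ e.2) hx
        rwa [zero_add] at this
      · rw [← Subalgebra.smul_def, ← mul_smul, he.1.eq])
    (fun k => by
      obtain ⟨x, hxQ, hx, hxP⟩ := htb k
      obtain ⟨e, he, hex⟩ := exists_isPrimitiveIdem (R := T)
        (P := (G k).1.restrictScalars T) hxP
      refine ⟨⟨e, he⟩, sectionMult_ne_zero_iff.2 ⟨e • x, (G (k + 1)).1.smul_mem _ hxQ, ?_, ?_, hex⟩⟩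
      · have := hY.2 _ _ _ _ (hT0 _ e.2) hx
        rwa [zero_add] at this
      · rw [← Subalgebra.smul_def, ← mul_smul, he.1.eq])
    (fun k j e hne => by
      obtain ⟨x, hxQ, hx, -, hxP⟩ := sectionMult_ne_zero_iff.1 hne
      by_contra! hlt
      exact hxP (hta' k j hlt x hxQ hx))
    (fun k j e hne => by
      obtain ⟨x, hxQ, hx, -, hxP⟩ := sectionMult_ne_zero_iff.1 hne
      by_contra! hlt
      exact hxP (htb' k j hlt x hxQ hx))
    (fun k l e hkl hne hne' => by
      obtain ⟨x, hxQ, hx, hex, hxP⟩ := sectionMult_ne_zero_iff.1 hne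
      obtain ⟨y, hyQ, hy, hey, hyP⟩ := sectionMult_ne_zero_iff.1 hne'
      have htop := hta' k
      have htop' : IsTopDegree 𝒩 (G l).1 (G (l + 1)).1 (ta k) := hkl ▸ htb' l
      have hxy : ∀ a : A, a • x ∈ (F k).1 ↔ a • y ∈ (G l).1 := fun a =>
        ⟨smul_mem_of_smul_mem h hX hY (hG l l.2) htop htop' e.2 hxQ hx hxP hex hyQ hy hyP hey,
          smul_mem_of_smul_mem h hY hX (hF k k.2) htop' htop e.2 hyQ hy hyP hey hxQ hx hxP hex⟩
      constructor
      · obtain ⟨f, hf⟩ := exists_section_equiv hxQ hyQ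
          (fun q hq => exists_smul_of_covBy h.internal hX (hF k k.2) hx hxQ hxP hq)
          (fun q hq => exists_smul_of_covBy h.internal hY (hG l l.2) hy hyQ hyP hq) hxy
        refine ⟨f, fun i => ?_⟩
        rw [factorPiece_eq h.internal hX (hF k k.2) hxQ hx hxP,
          factorPiece_eq h.internal hY (hG l l.2) hyQ hy hyP, Set.image_image]
        simp only [hf]
      · funext j e'
        have h1 := sectionMult_eq_of_ann h.internal hT0 h.isModuleGrading hX (hF k k.2) hxQ hx
          hxP e'.1.2 (congrArg Subtype.val e'.2.1.eq) j
        have h2 := sectionMult_eq_of_ann h.internal hT0 h.isModuleGrading hY (hG l l.2) hyQ hy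
          hyP e'.1.2 (congrArg Subtype.val e'.2.1.eq) j
        have h3 : (F k).1.comap (LinearMap.toSpanSingleton A X x) =
            (G l).1.comap (LinearMap.toSpanSingleton A Y y) := by
          ext a
          exact hxy a
        rw [← h2, h3] at h1
        exact Nat.add_right_cancel h1)
    (fun j e => by
      rw [sum_sectionMult n hF0 hF, sum_sectionMult m hG0 hG, hFn, hGm]
      exact hXY e.1 e.2 j)
  obtain rfl : n = m := by simpa using Fintype.card_congr σ
  have hmono : ∀ {Z : Type u} [AddCommGroup Z] [Module A Z] [Module K Z] [IsScalarTower K A Z]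
      {𝒵 : ℤ → Submodule K Z} {hZ : DirectSum.IsInternal 𝒵} (H : ℕ → GradedSub A hZ),
      (∀ i < n, H i ⋖ H (i + 1)) → Monotone fun i : Fin (n + 1) => (H i).1 :=
    fun H hH => Fin.monotone_iff_le_succ.2 fun i => (hH i i.2).le
  refine ⟨n, fun i => (F i).1, fun i => (G i).1, σ, hmono F hF, hmono G hG, hF0, ?_, hG0, ?_, hσ⟩
  · simpa using hFn
  · simpa using hGm

end Sections

end TriangularPaper

namespace TriangularPaper

section Corners

variable {K A : Type u} [Field K] [Ring A] [Algebra K A] {𝒜 : ℤ → Submodule K A}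
  {Am T Ap : Subalgebra K A}

/-- The elements of `V` fixed by `e` on the left and by `f` on the right. -/
def corner (V : Submodule K A) (e f : A) : Submodule K A :=
  V ⊓ LinearMap.eqLocus (LinearMap.mulLeft K e) LinearMap.id ⊓
    LinearMap.eqLocus (LinearMap.mulRight K f) LinearMap.id

lemma finrank_eq_of_nondegenerate {V W : Type*} [AddCommGroup V] [Module K V] [AddCommGroup W]
    [Module K W] [FiniteDimensional K V] [FiniteDimensional K W] (β : V →ₗ[K] W →ₗ[K] K)
    (hl : ∀ x, (∀ y, β x y = 0) → x = 0) (hr : ∀ y, (∀ x, β x y = 0) → y = 0) :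
    Module.finrank K V = Module.finrank K W := by
  refine le_antisymm ?_ ?_
  · rw [← Subspace.dual_finrank_eq (V := W)]
    exact LinearMap.finrank_le_finrank_of_injective (f := β)
      ((injective_iff_map_eq_zero β).2 fun x hx => hl x fun y => by rw [hx]; rfl)
  · rw [← Subspace.dual_finrank_eq (V := V)]
    exact LinearMap.finrank_le_finrank_of_injective (f := β.flip)
      ((injective_iff_map_eq_zero β.flip).2 fun y hy => hr y fun x => by
        rw [← LinearMap.flip_apply, hy]; rfl)

lemma Bneg_mul_mem {b t : A} (hb : b ∈ Bneg K A Am T) (ht : t ∈ T) : b * t ∈ Bneg K A Am T := by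
  rw [Bneg, ← subalgebra_mul_self T, ← mul_assoc]
  exact Submodule.mul_mem_mul hb ht

lemma Bpos_mul_mem {b t : A} (hb : b ∈ Bpos K A T Ap) (ht : t ∈ T) : b * t ∈ Bpos K A T Ap := by
  rw [Bpos, ← subalgebra_mul_self T, ← mul_assoc]
  exact Submodule.mul_mem_mul hb ht

namespace TriangularDecomposition

lemma mul_Bneg_mem (h : TriangularDecomposition K A 𝒜 Am T Ap) {b t : A} (ht : t ∈ T)
    (hb : b ∈ Bneg K A Am T) : t * b ∈ Bneg K A Am T := by
  rw [Bneg, h.comm_neg] at hb ⊢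
  rw [← subalgebra_mul_self T, mul_assoc]
  exact Submodule.mul_mem_mul ht hb

lemma mul_Bpos_mem (h : TriangularDecomposition K A 𝒜 Am T Ap) {b t : A} (ht : t ∈ T)
    (hb : b ∈ Bpos K A T Ap) : t * b ∈ Bpos K A T Ap := by
  rw [Bpos, h.comm_pos] at hb ⊢
  rw [← subalgebra_mul_self T, mul_assoc]
  exact Submodule.mul_mem_mul ht hb

lemma mul_mul_mem_degree (h : TriangularDecomposition K A 𝒜 Am T Ap) {s t b : A} {i : ℤ}
    (hs : s ∈ T) (ht : t ∈ T) (hb : b ∈ 𝒜 i) : s * b * t ∈ 𝒜 i := by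
  simpa using h.mul_mem _ _ _ _ (h.mul_mem _ _ _ _ (h.T_deg0 hs) hb) (h.T_deg0 ht)

lemma corner_Bneg_mem (h : TriangularDecomposition K A 𝒜 Am T Ap) {e f b : A} {i : ℤ}
    (he : e ∈ T) (hee : IsIdempotentElem e) (hf : f ∈ T) (hff : IsIdempotentElem f)
    (hb : b ∈ Bneg K A Am T ⊓ 𝒜 i) : e * b * f ∈ corner (Bneg K A Am T ⊓ 𝒜 i) e f :=
  ⟨⟨⟨Bneg_mul_mem (h.mul_Bneg_mem he hb.1) hf, h.mul_mul_mem_degree he hf hb.2⟩,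
    show e * (e * b * f) = e * b * f by simp only [← mul_assoc, hee.eq]⟩,
    show e * b * f * f = e * b * f by rw [mul_assoc, hff.eq]⟩

lemma corner_Bpos_mem (h : TriangularDecomposition K A 𝒜 Am T Ap) {e f b : A} {i : ℤ}
    (he : e ∈ T) (hee : IsIdempotentElem e) (hf : f ∈ T) (hff : IsIdempotentElem f)
    (hb : b ∈ Bpos K A T Ap ⊓ 𝒜 i) : e * b * f ∈ corner (Bpos K A T Ap ⊓ 𝒜 i) e f :=
  ⟨⟨⟨Bpos_mul_mem (h.mul_Bpos_mem he hb.1) hf, h.mul_mul_mem_degree he hf hb.2⟩,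
    show e * (e * b * f) = e * b * f by simp only [← mul_assoc, hee.eq]⟩,
    show e * b * f * f = e * b * f by rw [mul_assoc, hff.eq]⟩

end TriangularDecomposition

lemma finrank_corner_eq [FiniteDimensional K A] (h : TriangularDecomposition K A 𝒜 Am T Ap)
    {i j : ℤ} (β : ↥(Bneg K A Am T ⊓ 𝒜 i) →ₗ[K] ↥(Bpos K A T Ap ⊓ 𝒜 j) →ₗ[K] K)
    (hl : ∀ x, (∀ y, β x y = 0) → x = 0) (hr : ∀ y, (∀ x, β x y = 0) → y = 0)
    (hβ : ∀ (t t' : ↥T) (x x' : ↥(Bneg K A Am T ⊓ 𝒜 i)) (y y' : ↥(Bpos K A T Ap ⊓ 𝒜 j)),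
      (x' : A) = (t : A) * (x : A) * (t' : A) →
      (y' : A) = (t' : A) * (y : A) * (t : A) → β x' y = β x y')
    {e f : A} (he : e ∈ T) (hee : IsIdempotentElem e) (hf : f ∈ T) (hff : IsIdempotentElem f) :
    Module.finrank K (corner (Bneg K A Am T ⊓ 𝒜 i) e f) =
      Module.finrank K (corner (Bpos K A T Ap ⊓ 𝒜 j) f e) := by
  have hleft : corner (Bneg K A Am T ⊓ 𝒜 i) e f ≤ Bneg K A Am T ⊓ 𝒜 i := fun _ hx => hx.1.1
  have hright : corner (Bpos K A T Ap ⊓ 𝒜 j) f e ≤ Bpos K A T Ap ⊓ 𝒜 j := fun _ hx => hx.1.1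
  refine finrank_eq_of_nondegenerate
    (β.compl₁₂ (Submodule.inclusion hleft) (Submodule.inclusion hright))
    (fun x hx => ?_) fun y hy => ?_
  · have : Submodule.inclusion hleft x = 0 := hl _ fun y => by
      have hmem := h.corner_Bpos_mem hf hff he hee y.2
      have hx' : (x : A) = e * x * f := by
        rw [show e * (x : A) = x from x.2.1.2, show (x : A) * f = x from x.2.2]
      rw [hβ ⟨e, he⟩ ⟨f, hf⟩ (Submodule.inclusion hleft x) (Submodule.inclusion hleft x) y
        (Submodule.inclusion hright ⟨_, hmem⟩) hx' rfl]
      exact hx _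
    exact Submodule.inclusion_injective hleft (this.trans (map_zero _).symm)
  · have : Submodule.inclusion hright y = 0 := hr _ fun x => by
      have hmem := h.corner_Bneg_mem he hee hf hff x.2
      have hy' : (y : A) = f * y * e := by
        rw [show f * (y : A) = y from y.2.1.2, show (y : A) * e = y from y.2.2]
      rw [← hβ ⟨e, he⟩ ⟨f, hf⟩ x (Submodule.inclusion hleft ⟨_, hmem⟩)
        (Submodule.inclusion hright y) (Submodule.inclusion hright y) rfl hy']
      exact hy _
    exact Submodule.inclusion_injective hright (this.trans (map_zero _).symm)

end Corners

section Standard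

variable {K A : Type u} [Field K] [Ring A] [Algebra K A] {𝒜 : ℤ → Submodule K A}
  {Am T Ap : Subalgebra K A} {M : Type u} [AddCommGroup M] [Module T M]
  {D : Type u} [AddCommGroup D] [Module A D] {ι : M →+ D}

lemma IsProperStandardFor.exists_smul_eq [IsSimpleModule T M]
    (hD : IsProperStandardFor K A 𝒜 T Ap M D ι) {m : M} (hm : m ≠ 0) (x : D) :
    ∃ a : A, a • ι m = x := by
  let S : Submodule A D := LinearMap.range (LinearMap.toSpanSingleton A D (ι m))
  have hS : ∀ m', ι m' ∈ S := fun m' => by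
    obtain ⟨t, rfl⟩ := IsSimpleModule.toSpanSingleton_surjective T hm m'
    exact ⟨t, (hD.1 t m).symm⟩
  have := (hD.2.2 (D ⧸ S) 0 (by simp) (by simp)).unique (y₁ := S.mkQ) (y₂ := 0)
    (fun m' => by simpa using hS m') (by simp)
  have hx : S.mkQ x = 0 := by rw [this]; rfl
  exact (Submodule.Quotient.mk_eq_zero S).1 hx

lemma IsProperStandardFor.smul_apply_eq_zero (hD : IsProperStandardFor K A 𝒜 T Ap M D ι) {c : A}
    (hc : c ∈ ⊤ * Jpos K A 𝒜 T Ap) (m : M) : c • ι m = 0 := by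
  suffices ⊤ * Jpos K A 𝒜 T Ap ≤
      (LinearMap.ker (LinearMap.toSpanSingleton A D (ι m))).restrictScalars K from this hc
  refine Submodule.mul_le.2 fun a _ j hj => ?_
  change (a * j) • ι m = 0
  rw [mul_smul, hD.2.1 j hj, smul_zero]

lemma IsProperStandardFor.mem_of_smul_eq_zero [IsSimpleModule T M]
    (h : TriangularDecomposition K A 𝒜 Am T Ap)
    (hD : IsProperStandardFor K A 𝒜 T Ap M D ι) {f : T} (hf : IsPrimitiveIdem f) {m : M}
    (hm : m ≠ 0) (hfm : f • m = m) {b : A} (hbf : b * f = b) (hb : b • ι m = 0) :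
    b ∈ ⊤ * Jpos K A 𝒜 T Ap := by
  let L : Submodule A A :=
    { (⊤ * Jpos K A 𝒜 T Ap : Submodule K A) with
      smul_mem' := fun a x hx => by
        suffices ⊤ * Jpos K A 𝒜 T Ap ≤
          (⊤ * Jpos K A 𝒜 T Ap).comap (LinearMap.mulLeft K a) from this hx
        refine Submodule.mul_le.2 fun c _ j hj => ?_
        change a * (c * j) ∈ ⊤ * Jpos K A 𝒜 T Ap
        rw [← mul_assoc]
        exact Submodule.mul_mem_mul Submodule.mem_top hj }
  have hJ : ∀ a ∈ Jpos K A 𝒜 T Ap, a ∈ L := fun a ha => by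
    have : (1 : A) * a ∈ ⊤ * Jpos K A 𝒜 T Ap := Submodule.mul_mem_mul Submodule.mem_top ha
    rwa [one_mul] at this
  obtain ⟨g, hg⟩ := hf.exists_linearMap (V := A ⧸ L) (v := L.mkQ (f : A)) hm hfm
    (congrArg L.mkQ (congrArg Subtype.val hf.1.eq))
  obtain ⟨F, hF, -⟩ := hD.2.2 (A ⧸ L) g.toAddMonoidHom (fun t m' => g.map_smul t m')
    fun a ha m' => by
      obtain ⟨t, rfl⟩ := IsSimpleModule.toSpanSingleton_surjective T hm m'
      change a • g (t • m) = 0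
      rw [map_smul, hg]
      refine (Submodule.Quotient.mk_eq_zero L).2 (hJ (a * (t * f)) ?_)
      rw [← h.Jpos_mul]
      exact Submodule.mul_mem_mul ha (t * f).2
  have : L.mkQ b = 0 := by
    rw [← map_zero F, ← hb, map_smul, hF]
    change _ = b • g m
    rw [hg, ← map_smul, smul_eq_mul, hbf]
  exact (Submodule.Quotient.mk_eq_zero L).1 this

variable [Module K D] [IsScalarTower K A D] {ℳ : ℤ → Submodule K D}

lemma IsProperStandardFor.finiteDimensional [FiniteDimensional K A] [IsSimpleModule T M]
    (hD : IsProperStandardFor K A 𝒜 T Ap M D ι) {m : M} (hm : m ≠ 0) : FiniteDimensional K D :=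
  Module.Finite.of_surjective ((LinearMap.toSpanSingleton A D (ι m)).restrictScalars K)
    (hD.exists_smul_eq hm)

lemma IsProperStandardFor.finrank_weightSpace [IsSimpleModule T M]
    (h : TriangularDecomposition K A 𝒜 Am T Ap)
    (hD : IsProperStandardFor K A 𝒜 T Ap M D ι) (hℳ : IsModuleGrading K A 𝒜 ℳ) {d : ℤ}
    (hd : ∀ m, ι m ∈ ℳ d) {f : T} (hf : IsPrimitiveIdem f) {m : M} (hm : m ≠ 0)
    (hfm : f • m = m) {e : T} (he : IsIdempotentElem e) (i : ℤ) :
    Module.finrank K (weightSpace ℳ (e : A) i ⊤) =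
      Module.finrank K (corner (Bneg K A Am T ⊓ 𝒜 (i - d)) (e : A) f) := by
  have heA : IsIdempotentElem (e : A) := congrArg Subtype.val he.eq
  have hfA : IsIdempotentElem (f : A) := congrArg Subtype.val hf.1.eq
  have hmem : ∀ b ∈ corner (Bneg K A Am T ⊓ 𝒜 (i - d)) (e : A) f,
      ((LinearMap.toSpanSingleton A D (ι m)).restrictScalars K) b ∈ weightSpace ℳ (e : A) i ⊤ := by
    intro b hb
    refine ⟨⟨Submodule.mem_top, ?_⟩, ?_⟩
    · simpa using hℳ.2 _ _ _ _ hb.1.1.2 (hd m)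
    · change (e : A) • b • ι m = b • ι m
      rw [← mul_smul, show (e : A) * b = b from hb.1.2]
  refine (LinearEquiv.ofBijective (LinearMap.restrict _ hmem) ⟨?_, ?_⟩).finrank_eq.symm
  · refine (injective_iff_map_eq_zero _).2 fun b hb => Subtype.ext ?_
    have hb0 : (b : A) • ι m = 0 := congrArg Subtype.val hb
    have := hD.mem_of_smul_eq_zero h hf hm hfm b.2.2 hb0
    exact (Submodule.eq_bot_iff _).1 h.Bneg_inf_eq_bot _ ⟨b.2.1.1.1, this⟩
  · rintro ⟨x, ⟨-, hx⟩, hex⟩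
    replace hex : (e : A) • x = x := hex
    obtain ⟨a, rfl⟩ := hD.exists_smul_eq hm x
    obtain ⟨b, hb, c, hc, rfl⟩ := Submodule.mem_sup.1
      (h.Bneg_sup_eq_top.ge (Submodule.mem_top (x := a)))
    rw [add_smul, hD.smul_apply_eq_zero hc, add_zero] at hx hex
    refine ⟨⟨_, h.corner_Bneg_mem e.2 heA f.2 hfA
      ⟨h.Bneg_homogeneous b hb (i - d), degreeProj_mem _ _ _⟩⟩, Subtype.ext ?_⟩
    change ((e : A) * degreeProj h.internal (i - d) b * f) • ι m = (b + c) • ι m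
    rw [mul_smul, ← hD.1, hfm, mul_smul, ← degreeProj_smul_of_mem h.internal hℳ (hd m),
      degreeProj_of_mem hℳ.1 hx, hex, add_smul, hD.smul_apply_eq_zero hc, add_zero]

end Standard

section Costandard

variable {K A : Type u} [Field K] [Ring A] [Algebra K A] {𝒜 : ℤ → Submodule K A}
  {Am T Ap : Subalgebra K A} {M : Type u} [AddCommGroup M] [Module T M]
  {D : Type u} [AddCommGroup D] [Module A D] {p : D →+ M}

lemma IsProperCostandardFor.exists_apply_smul_ne_zero
    (hD : IsProperCostandardFor K A 𝒜 Am T M D p) {x : D} (hx : x ≠ 0) :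
    ∃ a : A, p (a • x) ≠ 0 := by
  by_contra! hcon
  let N : Submodule A D := Submodule.span A {x}
  have hN : ∀ n ∈ N, p n = 0 := fun n hn => by
    obtain ⟨a, rfl⟩ := Submodule.mem_span_singleton.1 hn
    exact hcon a
  have := (hD.2.2 N 0 (by simp) (by simp)).unique (y₁ := N.subtype) (y₂ := 0)
    (fun n => by simpa using hN n n.2) (by simp)
  exact hx (LinearMap.congr_fun this ⟨x, Submodule.mem_span_singleton_self x⟩)

lemma IsProperCostandardFor.apply_smul_eq_zero (hD : IsProperCostandardFor K A 𝒜 Am T M D p)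
    {c : A} (hc : c ∈ Jneg K A 𝒜 Am T * ⊤) (x : D) : p (c • x) = 0 := by
  refine Submodule.mul_induction_on hc (fun j hj a _ => ?_) fun c c' hc hc' => ?_
  · rw [mul_smul, hD.2.1 j hj]
  · rw [add_smul, map_add, hc, hc', add_zero]

lemma IsProperCostandardFor.exists_apply_smul_eq [IsSemisimpleRing T] [IsSimpleModule T M]
    (h : TriangularDecomposition K A 𝒜 Am T Ap)
    (hD : IsProperCostandardFor K A 𝒜 Am T M D p) {f : T} (hf : IsPrimitiveIdem f) {m : M}
    (hm : m ≠ 0) (hfm : f • m = m) {y : A} (hy : y ∉ Jneg K A 𝒜 Am T * ⊤) (hfy : f * y = y) :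
    ∃ x : D, p (y • x) = m := by
  let R : Submodule T A :=
    { (Jneg K A 𝒜 Am T * ⊤ : Submodule K A) with
      smul_mem' := fun t x hx => by
        have := Submodule.mul_mem_mul (show (t : A) ∈ T.toSubmodule from t.2) hx
        rwa [← mul_assoc, h.mul_Jneg] at this }
  have hR : ∀ {z : A}, R.mkQ z = 0 ↔ z ∈ Jneg K A 𝒜 Am T * ⊤ := Submodule.Quotient.mk_eq_zero R
  obtain ⟨l, hl⟩ := hf.exists_linearMap_to (V := A ⧸ R) (v := R.mkQ y) hm hfm
    (fun h0 => hy (hR.1 h0)) (congrArg R.mkQ hfy)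
  obtain ⟨F, hF, -⟩ := hD.2.2 A (l ∘ₗ R.mkQ).toAddMonoidHom
    (fun t x => (l ∘ₗ R.mkQ).map_smul t x) fun a ha x => by
      have hax : a * x ∈ Jneg K A 𝒜 Am T * ⊤ := Submodule.mul_mem_mul ha Submodule.mem_top
      change l (R.mkQ (a * x)) = 0
      rw [hR.2 hax, map_zero]
  refine ⟨F 1, ?_⟩
  rw [← map_smul, smul_eq_mul, mul_one, hF]
  exact hl

variable [Module K M] [IsScalarTower K T M] [Module K D] [IsScalarTower K A D]
  {𝒩 : ℤ → Submodule K D}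

lemma IsProperCostandardFor.apply_scalar_smul (hD : IsProperCostandardFor K A 𝒜 Am T M D p) (k : K)
    (x : D) : p (k • x) = k • p x := by
  have := hD.1 (algebraMap K T k) x
  rwa [algebraMap_smul, Subalgebra.coe_algebraMap, algebraMap_smul] at this

lemma IsProperCostandardFor.finiteDimensional [FiniteDimensional K A] [FiniteDimensional K M]
    (hD : IsProperCostandardFor K A 𝒜 Am T M D p) : FiniteDimensional K D := by
  let g : D →ₗ[K] A →ₗ[K] M := LinearMap.mk₂ K (fun x a => p (a • x))
    (fun x y a => by rw [smul_add, map_add])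
    (fun k x a => by rw [smul_comm, hD.apply_scalar_smul])
    (fun x a b => by rw [add_smul, map_add])
    (fun k x a => by rw [smul_assoc, hD.apply_scalar_smul])
  refine Module.Finite.of_injective g ((injective_iff_map_eq_zero g).2 fun x hx => ?_)
  by_contra hx0
  obtain ⟨a, ha⟩ := hD.exists_apply_smul_ne_zero hx0
  exact ha (LinearMap.congr_fun hx a)

lemma IsProperCostandardFor.finrank_weightSpace [FiniteDimensional K A] [FiniteDimensional K D]
    [IsSemisimpleRing T] [IsSimpleModule T M] (h : TriangularDecomposition K A 𝒜 Am T Ap)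
    (hD : IsProperCostandardFor K A 𝒜 Am T M D p) (h𝒩 : IsModuleGrading K A 𝒜 𝒩) {d : ℤ}
    (hd : ∀ i, i ≠ d → ∀ x ∈ 𝒩 i, p x = 0) {f : T} (hf : IsPrimitiveIdem f) {m : M} (hm : m ≠ 0)
    (hfm : f • m = m) {e : T} (he : IsIdempotentElem e) {i j : ℤ} (hij : j + i = d) :
    Module.finrank K (weightSpace 𝒩 (e : A) i ⊤) =
      Module.finrank K (corner (Bpos K A T Ap ⊓ 𝒜 j) (f : A) e) := by
  have heA : IsIdempotentElem (e : A) := congrArg Subtype.val he.eq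
  have hfA : IsIdempotentElem (f : A) := congrArg Subtype.val hf.1.eq
  obtain ⟨θ, hθ⟩ : ∃ θ : M →ₗ[K] K, θ m ≠ 0 := by
    by_contra! hcon
    exact hm ((Module.forall_dual_apply_eq_zero_iff K m).1 hcon)
  have hproj : ∀ x, p (degreeProj h𝒩.1 d x) = p x := by
    intro x
    obtain ⟨s, hs⟩ := exists_sum_degreeProj h𝒩.1 x
    conv_rhs => rw [hs]
    conv_lhs => rw [hs]
    rw [map_sum, map_sum, map_sum]
    refine Finset.sum_congr rfl fun k _ => ?_
    by_cases hk : k = d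
    · subst hk
      rw [degreeProj_of_mem h𝒩.1 (degreeProj_mem _ _ _)]
    · rw [degreeProj_of_mem_ne h𝒩.1 (degreeProj_mem _ _ _) hk, map_zero,
        hd k hk _ (degreeProj_mem _ _ _)]
  let β : D →ₗ[K] A →ₗ[K] K := LinearMap.mk₂ K (fun x a => θ (p (a • x)))
    (fun x y a => by rw [smul_add, map_add, map_add])
    (fun k x a => by rw [smul_comm, hD.apply_scalar_smul, map_smul])
    (fun x a b => by rw [add_smul, map_add, map_add])
    (fun k x a => by rw [smul_assoc, hD.apply_scalar_smul, map_smul])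
  refine finrank_eq_of_nondegenerate (β.domRestrict₁₂ _ _) (fun x hx => ?_) fun y hy => ?_
  · by_contra hx0
    obtain ⟨a, ha⟩ := hD.exists_apply_smul_ne_zero
      (x := (x : D)) fun h0 => hx0 (Subtype.ext h0)
    obtain ⟨b, hb, c, hc, rfl⟩ := Submodule.mem_sup.1
      (h.Bpos_sup_eq_top.ge (Submodule.mem_top (x := a)))
    rw [add_smul, map_add, hD.apply_smul_eq_zero hc, add_zero, ← hproj,
      degreeProj_smul_of_mem h.internal h𝒩 x.2.1.2, show d - i = j by omega] at ha
    obtain ⟨t, ht⟩ := IsSimpleModule.toSpanSingleton_surjective T ha m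
    have hmem := h.corner_Bpos_mem f.2 hfA e.2 heA (i := j) (b := t * degreeProj h.internal j b)
      ⟨h.mul_Bpos_mem t.2 (h.Bpos_homogeneous b hb j),
        by simpa using h.mul_mem _ _ _ _ (h.T_deg0 t.2) (degreeProj_mem h.internal j b)⟩
    have := hx ⟨_, hmem⟩
    change θ (p (((f : A) * (t * degreeProj h.internal j b) * e) • (x : D))) = 0 at this
    rw [mul_smul, show (e : A) • (x : D) = x from x.2.2, mul_smul, mul_smul, hD.1, hD.1] at this
    exact hθ (by rwa [show t • p (degreeProj h.internal j b • (x : D)) = m from ht, hfm] at this)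
  · by_contra hy0
    have hyR : (y : A) ∉ Jneg K A 𝒜 Am T * ⊤ := fun hmem =>
      hy0 (Subtype.ext ((Submodule.eq_bot_iff _).1 h.Bpos_inf_eq_bot _ ⟨y.2.1.1.1, hmem⟩))
    obtain ⟨x, hx⟩ := hD.exists_apply_smul_eq h hf hm hfm hyR y.2.1.2
    have hmem : (e : A) • degreeProj h𝒩.1 i x ∈ weightSpace 𝒩 (e : A) i ⊤ := by
      refine ⟨⟨Submodule.mem_top, ?_⟩, ?_⟩
      · simpa using h𝒩.2 _ _ _ _ (h.T_deg0 e.2) (degreeProj_mem h𝒩.1 i x)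
      · change (e : A) • (e : A) • degreeProj h𝒩.1 i x = (e : A) • degreeProj h𝒩.1 i x
        rw [← mul_smul, heA.eq]
    have := hy ⟨_, hmem⟩
    change θ (p ((y : A) • (e : A) • degreeProj h𝒩.1 i x)) = 0 at this
    rw [← mul_smul, show (y : A) * e = y from y.2.2, show i = d - j by omega,
      ← degreeProj_smul h𝒩 y.2.1.1.2, hproj, hx] at this
    exact hθ this

end Costandard

end TriangularPaper

namespace TriangularPaper

/-- Suppose `T` is (split) semisimple.  If `B⁻ᵢ ≅ (B⁺₋ᵢ)^⊛` as
`T`-bimodules for all `i` (witnessed by nondegenerate pairings `B⁻ᵢ × B⁺₋ᵢ → K`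
satisfying `⟨t·x·t', y⟩ = ⟨x, t'·y·t⟩`), then `A` is BGG:
`[Δ̄(λ)] = [∇̄(λ)]` in `K₀(𝒢(A))` for every simple graded `T`-module `λ`. -/
theorem bgg_of_borel_duality (K A : Type u) [Field K] [Ring A] [Algebra K A]
    [FiniteDimensional K A] (𝒜 : ℤ → Submodule K A) (Am T Ap : Subalgebra K A)
    (h : TriangularDecomposition K A 𝒜 Am T Ap)
    (hT : IsSemisimpleRing ↥T)
    -- `B⁻ᵢ ≅ (B⁺₋ᵢ)^⊛` as graded `T`-bimodules:
    (hdual : ∀ i : ℤ, ∃ β : ↥(Bneg K A Am T ⊓ 𝒜 i) →ₗ[K] ↥(Bpos K A T Ap ⊓ 𝒜 (-i)) →ₗ[K] K,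
      (∀ x, (∀ y, β x y = 0) → x = 0) ∧
      (∀ y, (∀ x, β x y = 0) → y = 0) ∧
      (∀ (t t' : ↥T) (x x' : ↥(Bneg K A Am T ⊓ 𝒜 i))
         (y y' : ↥(Bpos K A T Ap ⊓ 𝒜 (-i))),
        (x' : A) = (t : A) * (x : A) * (t' : A) →
        (y' : A) = (t' : A) * (y : A) * (t : A) → β x' y = β x y')) :
    -- then for every simple graded `T`-module `λ = (M, d)`, `[Δ̄(λ)] = [∇̄(λ)]`:
    ∀ (d : ℤ) (M : Type u) (_ : AddCommGroup M) (_ : Module ↥T M),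
      IsSimpleModule ↥T M →
      ∀ (D : Type u) (_ : AddCommGroup D) (_ : Module A D) (_ : Module K D)
        (_ : IsScalarTower K A D) (ι : M →+ D) (ℳ : ℤ → Submodule K D),
        IsProperStandardFor K A 𝒜 T Ap M D ι →
        IsModuleGrading K A 𝒜 ℳ → (∀ m : M, ι m ∈ ℳ d) →
      ∀ (D' : Type u) (_ : AddCommGroup D') (_ : Module A D') (_ : Module K D')
        (_ : IsScalarTower K A D') (p : D' →+ M) (𝒩 : ℤ → Submodule K D'),
        IsProperCostandardFor K A 𝒜 Am T M D' p →
        IsModuleGrading K A 𝒜 𝒩 → (∀ i : ℤ, i ≠ d → ∀ x ∈ 𝒩 i, p x = 0) →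
      GradedMatchingFactors K A ℳ 𝒩 := by
  intro d M _ _ hM D _ _ _ _ ι ℳ hD hℳ hι D' _ _ _ _ p 𝒩 hD' h𝒩 hp
  let : Module K M := Module.compHom M (algebraMap K T)
  have : IsScalarTower K T M := ⟨fun k t m => by
    rw [Algebra.smul_def, mul_smul]
    rfl⟩
  have := hM.nontrivial
  obtain ⟨m', hm'⟩ := exists_ne (0 : M)
  obtain ⟨f, hf, hfm'⟩ := exists_isPrimitiveIdem (R := T) (P := (⊥ : Submodule T M)) (x := m') hm'
  set m := f • m'
  have hfm : f • m = m := by rw [← mul_smul, hf.1.eq]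
  have : FiniteDimensional K M := Module.Finite.of_surjective
    ((LinearMap.toSpanSingleton T M m).restrictScalars K)
    (IsSimpleModule.toSpanSingleton_surjective T hfm')
  have := hD.finiteDimensional hfm'
  have := hD'.finiteDimensional
  refine gradedMatchingFactors_of_finrank_eq h hℳ h𝒩 fun e he i => ?_
  obtain ⟨β, hl, hr, hβ⟩ := hdual (i - d)
  rw [hD.finrank_weightSpace h hℳ hι hf hfm' hfm he.1,
    hD'.finrank_weightSpace h h𝒩 hp hf hfm' hfm he.1 (show -(i - d) + i = d by omega)]
  exact finrank_corner_eq h β hl hr hβ e.2 (congrArg Subtype.val he.1.eq) f.2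
    (congrArg Subtype.val hf.1.eq)

end TriangularPaper
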